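/- There exists c₇∈(0,+∞) such that for each ε∈(0,1), all g₁,g₂∈Γ_ε, all w∈W_* and all τ∈I: ρ_Γ(ℋ_Γ(g₁M_{wτ})^{1/d}·g₁M_{wτ}, ℋ_Γ(g₂M_{wτ})^{1/d}·g₂M_{wτ}) ≤ c₇·ε^{−45d}·ρ_Γ(g₁,g₂), where wτ denotes the concatenation of the words w and τ. -/

import Mathlib

open MeasureTheory Filter Topology Matrix
open scoped ENNReal NNReal BigOperators

noncomputable section

/-- `D` is an open (round) disk in `ℂ`. -/
def IsOpenDisk (D : Set ℂ) : Prop := ∃ z : ℂ, ∃ r : ℝ, 0 < r ∧ D = Metric.ball z r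

/-- `D` is an open half-plane in `ℂ`. -/
def IsOpenHalfPlane (D : Set ℂ) : Prop :=
  ∃ a : ℂ, a ≠ 0 ∧ ∃ c : ℝ, D = {z : ℂ | (a * z).re < c}

/-- The center of an open disk (junk value otherwise). -/
noncomputable def diskCenter (D : Set ℂ) : ℂ :=
  Classical.epsilon fun z : ℂ => ∃ r : ℝ, 0 < r ∧ D = Metric.ball z r

/-- The radius of an open disk (junk value otherwise). -/
noncomputable def diskRadius (D : Set ℂ) : ℝ :=
  Classical.epsilon fun r : ℝ => 0 < r ∧ ∃ z : ℂ, D = Metric.ball z r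

/-- The curvature of `D`: the reciprocal of the radius for an open disk,
and `0` for a half-plane (or anything that is not an open disk). -/
noncomputable def curv (D : Set ℂ) : ℝ :=
  haveI := Classical.propDecidable (IsOpenDisk D)
  if IsOpenDisk D then (diskRadius D)⁻¹ else 0

/-- A tangential disk triple: each member is an open disk or an open half-plane
(at most one half-plane), and the closures of distinct members meet in exactly one point. -/
def IsTDT (𝒟 : Fin 3 → Set ℂ) : Prop :=
  ((∀ j, IsOpenDisk (𝒟 j)) ∨
    (∃ j, IsOpenHalfPlane (𝒟 j) ∧ ∀ k, k ≠ j → IsOpenDisk (𝒟 k))) ∧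
  ∀ j k, j ≠ k → ∃ p : ℂ, closure (𝒟 j) ∩ closure (𝒟 k) = {p}

/-- The ideal triangle `T(𝒟)`: the unique bounded connected component of
`ℂ ∖ (closure D₁ ∪ closure D₂ ∪ closure D₃)`. -/
noncomputable def idealTriangle (𝒟 : Fin 3 → Set ℂ) : Set ℂ :=
  Classical.epsilon fun T : Set ℂ =>
    Bornology.IsBounded T ∧
    ∃ z ∈ (⋃ j, closure (𝒟 j))ᶜ, T = connectedComponentIn (⋃ j, closure (𝒟 j))ᶜ z

/-- `q_j(𝒟)`: the tangency point of the two members other than the `j`-th one. -/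
noncomputable def tangencyPoint (𝒟 : Fin 3 → Set ℂ) (j : Fin 3) : ℂ :=
  Classical.epsilon fun p : ℂ => closure (𝒟 (j + 1)) ∩ closure (𝒟 (j + 2)) = {p}

/-- `𝒟` is a positively oriented tangential disk triple: the tangency points
`q₁(𝒟), q₂(𝒟), q₃(𝒟)` occur in counterclockwise order, i.e. the ideal triangle
lies to the left of its boundary oriented through `q₁(𝒟), q₂(𝒟), q₃(𝒟)` in this order. -/
def IsTDTplus (𝒟 : Fin 3 → Set ℂ) : Prop :=
  IsTDT 𝒟 ∧
  0 < ((tangencyPoint 𝒟 1 - tangencyPoint 𝒟 0).re *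
        (tangencyPoint 𝒟 2 - tangencyPoint 𝒟 0).im -
       (tangencyPoint 𝒟 1 - tangencyPoint 𝒟 0).im *
        (tangencyPoint 𝒟 2 - tangencyPoint 𝒟 0).re)

/-- `D` is an inscribed disk of the ideal triangle of `𝒟`. -/
def IsInscribedDisk (𝒟 : Fin 3 → Set ℂ) (D : Set ℂ) : Prop :=
  IsOpenDisk D ∧ D ⊆ idealTriangle 𝒟 ∧ ∀ j, ∃ p : ℂ, closure D ∩ closure (𝒟 j) = {p}

/-- The inscribed disk `D_in(𝒟)` of the ideal triangle of `𝒟`. -/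
noncomputable def Din (𝒟 : Fin 3 → Set ℂ) : Set ℂ := Classical.epsilon (IsInscribedDisk 𝒟)

/-- `Φ_j(𝒟)`: replace the `j`-th entry of `𝒟` by the inscribed disk `D_in(𝒟)`. -/
noncomputable def Phi (j : Fin 3) (𝒟 : Fin 3 → Set ℂ) : Fin 3 → Set ℂ :=
  Function.update 𝒟 j (Din 𝒟)

/-- Finite words over the alphabet `{1,2,3}` (represented by `Fin 3`). -/
abbrev Word := List (Fin 3)

/-- `𝒟_w = Φ_w(𝒟) = (Φ_{w_m} ∘ ⋯ ∘ Φ_{w_1})(𝒟)`. -/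
noncomputable def applyWord (𝒟 : Fin 3 → Set ℂ) (w : Word) : Fin 3 → Set ℂ :=
  w.foldl (fun D j => Phi j D) 𝒟

/-- The Apollonian gasket `K(𝒟)` associated with `𝒟`. -/
noncomputable def AG (𝒟 : Fin 3 → Set ℂ) : Set ℂ :=
  closure (idealTriangle 𝒟) \ ⋃ w : Word, Din (applyWord 𝒟 w)

/-- A concrete positively oriented tangential disk triple. -/
noncomputable def baseTriple : Fin 3 → Set ℂ :=
  ![{z : ℂ | 1 < z.im},
    Metric.ball (Complex.I / 2 - 1 / 2) (1 / 2),
    Metric.ball (Complex.I / 2 + 1 / 2) (1 / 2)]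

/-- `d`, the Hausdorff dimension of the Apollonian gasket
(independent of the choice of `𝒟 ∈ TDT⁺`). -/
noncomputable def dAG : ℝ := (dimH (AG baseTriple)).toReal

/-- The matrices `M₁, M₂, M₃`. -/
def Mmat : Fin 3 → Matrix (Fin 4) (Fin 4) ℝ :=
  ![!![1,0,0,0; 1,1,0,1; 1,0,1,1; 2,0,0,1],
    !![1,1,0,1; 0,1,0,0; 0,1,1,1; 0,2,0,1],
    !![1,0,1,1; 0,1,1,1; 0,0,1,0; 0,0,2,1]]

/-- `M_w := M_{w₁} ⋯ M_{w_m}` (`M_∅` is the identity matrix). -/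
def Mword (w : Word) : Matrix (Fin 4) (Fin 4) ℝ := (w.map Mmat).prod

/-- `κ(α,β,γ) := √(βγ + γα + αβ)`. -/
noncomputable def kappa (α β γ : ℝ) : ℝ := Real.sqrt (β * γ + γ * α + α * β)

/-- The row vector `(curv D₁, curv D₂, curv D₃, κ(𝒟))`. -/
noncomputable def curvVec (𝒟 : Fin 3 → Set ℂ) : Fin 4 → ℝ :=
  ![curv (𝒟 0), curv (𝒟 1), curv (𝒟 2),
    kappa (curv (𝒟 0)) (curv (𝒟 1)) (curv (𝒟 2))]

/-- The parameter space `Γ = {(g, κ(g)) : g ∈ [0,∞)³, κ(g) > 0} ⊆ [0,∞)⁴`. -/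
def Gamma : Set (Fin 4 → ℝ) :=
  {g | 0 ≤ g 0 ∧ 0 ≤ g 1 ∧ 0 ≤ g 2 ∧ g 3 = kappa (g 0) (g 1) (g 2) ∧ 0 < g 3}

/-- `Γ° := Γ ∩ (0,∞)⁴`. -/
def GammaInt : Set (Fin 4 → ℝ) := {g | g ∈ Gamma ∧ ∀ i, 0 < g i}

/-- The compact subset `Γ_ε` of `Γ`. -/
def GammaEps (ε : ℝ) : Set (Fin 4 → ℝ) :=
  {g | g 0 ∈ Set.Icc 0 ε⁻¹ ∧ g 1 ∈ Set.Icc 0 ε⁻¹ ∧ g 2 ∈ Set.Icc 0 ε⁻¹ ∧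
       g 3 = kappa (g 0) (g 1) (g 2) ∧
       ε ≤ g 1 + g 2 ∧ ε ≤ g 2 + g 0 ∧ ε ≤ g 0 + g 1}

/-- The Euclidean norm on `ℝ⁴`. -/
noncomputable def euclNorm4 (g : Fin 4 → ℝ) : ℝ := Real.sqrt (∑ i, g i ^ 2)

/-- The metric `ρ_Γ` on `Γ`: the Euclidean distance of the first three coordinates. -/
noncomputable def rhoGamma (g₁ g₂ : Fin 4 → ℝ) : ℝ :=
  Real.sqrt ((g₁ 0 - g₂ 0) ^ 2 + (g₁ 1 - g₂ 1) ^ 2 + (g₁ 2 - g₂ 2) ^ 2)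

/-- A positively oriented tangential disk triple with prescribed curvatures
`(g 0, g 1, g 2)` (junk value if none exists). -/
noncomputable def tripleOf (g : Fin 4 → ℝ) : Fin 3 → Set ℂ :=
  Classical.epsilon fun 𝒟 : Fin 3 → Set ℂ =>
    IsTDTplus 𝒟 ∧ curv (𝒟 0) = g 0 ∧ curv (𝒟 1) = g 1 ∧ curv (𝒟 2) = g 2

/-- `ℋ_Γ(g)`: the `d`-dimensional Hausdorff measure of the Apollonian gasket `K(𝒟)`
for any `𝒟 ∈ TDT⁺` whose members have curvatures `(g 0, g 1, g 2)`. -/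
noncomputable def HGamma (g : Fin 4 → ℝ) : ℝ :=
  (μH[dAG] (AG (tripleOf g))).toReal

/-- The operator norm of a `4 × 4` real matrix with respect to the Euclidean norm on `ℝ⁴`. -/
noncomputable def opNorm4 (M : Matrix (Fin 4) (Fin 4) ℝ) : ℝ :=
  sSup {t : ℝ | ∃ v : Fin 4 → ℝ, euclNorm4 v ≤ 1 ∧ t = euclNorm4 (M.mulVec v)}

/-- The set of words `I = {jⁿk : j,k ∈ S, j ≠ k, n ∈ ℕ}`. -/
def IdxI : Set Word :=
  {w | ∃ j k : Fin 3, j ≠ k ∧ ∃ n : ℕ, 0 < n ∧ w = List.replicate n j ++ [k]}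

end

namespace Apollonian

/-- The quadratic function whose negativity set is a generalized disk. -/
def circleFn (a b e c : ℝ) (z : ℂ) : ℝ :=
  a * (z.re ^ 2 + z.im ^ 2) - 2 * b * z.re - 2 * e * z.im + c

theorem continuous_circleFn (a b e c : ℝ) : Continuous (circleFn a b e c) := by
  unfold circleFn; fun_prop

theorem isOpen_circleFn_neg (a b e c : ℝ) : IsOpen {z | circleFn a b e c z < 0} :=
  isOpen_lt (continuous_circleFn a b e c) continuous_const

/-- The closed generalized disk is the closure of the open one. -/
theorem closure_circleFn_neg {a b e c : ℝ} (h : b ^ 2 + e ^ 2 - a * c = 1) :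
    closure {z | circleFn a b e c z < 0} = {z | circleFn a b e c z ≤ 0} := by
  apply Set.Subset.antisymm
  · exact closure_minimal (Set.ofPred_subset_ofPred.2 fun z hz => le_of_lt hz)
      (isClosed_le (continuous_circleFn a b e c) continuous_const)
  · intro z hz
    rcases lt_or_eq_of_le (show circleFn a b e c z ≤ 0 from hz) with h0 | h0
    · exact subset_closure h0
    · let γ : ℝ → ℂ := fun t => ⟨z.re - t * (a * z.re - b), z.im - t * (a * z.im - e)⟩
      have hγ : Continuous γ := by
        have : γ = fun t : ℝ => ((z.re - t * (a * z.re - b) : ℝ) : ℂ) +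
            ((z.im - t * (a * z.im - e) : ℝ) : ℂ) * Complex.I := by
          funext t; apply Complex.ext <;> simp [γ]
        rw [this]; fun_prop
      have hγ0 : γ 0 = z := by apply Complex.ext <;> simp [γ]
      have ht : Tendsto γ (𝓝[>] 0) (𝓝 z) := by
        have := (hγ.tendsto 0).mono_left (nhdsWithin_le_nhds (s := Set.Ioi 0))
        rwa [hγ0] at this
      have hsmall : ∀ᶠ t : ℝ in 𝓝[>] 0, a * t < 2 := by
        have : Continuous fun t : ℝ => a * t := by fun_prop
        have h2 := this.tendsto 0
        simp only [mul_zero] at h2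
        exact (h2.mono_left nhdsWithin_le_nhds).eventually (gt_mem_nhds (by norm_num))
      refine mem_closure_of_tendsto ht ?_
      filter_upwards [hsmall, self_mem_nhdsWithin] with t h1 h2
      have h2 : 0 < t := h2
      have key : circleFn a b e c (γ t) = t * (a * t - 2) := by
        simp only [circleFn] at h0
        simp only [circleFn, γ]
        linear_combination (1 - 2 * a * t + a ^ 2 * t ^ 2) * h0 + (- 2 * t + a * t ^ 2) * h
      show circleFn a b e c (γ t) < 0
      rw [key]
      nlinarith

/-- Generalized disks whose closures meet in one point are externally tangent. -/
theorem gram_of_inter_eq_singleton {a b e c a' b' e' c' : ℝ} (ha : 0 ≤ a) (ha' : 0 ≤ a')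
    (h : b ^ 2 + e ^ 2 - a * c = 1) (h' : b' ^ 2 + e' ^ 2 - a' * c' = 1) {p : ℂ}
    (hp : {z | circleFn a b e c z ≤ 0} ∩ {z | circleFn a' b' e' c' z ≤ 0} = {p}) :
    b * b' + e * e' - (a * c' + a' * c) / 2 = -1 := by
  have hdisj : ∀ z, circleFn a b e c z < 0 → circleFn a' b' e' c' z < 0 → False := by
    intro z h1 h2
    have hop := (isOpen_circleFn_neg a b e c).inter (isOpen_circleFn_neg a' b' e' c')
    have hsub : {z | circleFn a b e c z < 0} ∩ {z | circleFn a' b' e' c' z < 0} ⊆ {p} := by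
      rw [← hp]; 
      exact Set.inter_subset_inter (Set.ofPred_subset_ofPred.2 fun _ => le_of_lt)
        (Set.ofPred_subset_ofPred.2 fun _ => le_of_lt)
    have heq : {z | circleFn a b e c z < 0} ∩ {z | circleFn a' b' e' c' z < 0} = {p} :=
      hsub.antisymm (Set.singleton_subset_iff.2 ((hsub ⟨h1, h2⟩ : z = p) ▸ ⟨h1, h2⟩))
    rw [heq] at hop
    exact not_isOpen_singleton p hop
  have hpm : p ∈ {z | circleFn a b e c z ≤ 0} ∩ {z | circleFn a' b' e' c' z ≤ 0} := by
    rw [hp]; rfl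
  have h0 : circleFn a b e c p = 0 := by
    refine le_antisymm hpm.1 (not_lt.1 fun hlt => ?_)
    have hcl : p ∈ closure {z | circleFn a' b' e' c' z < 0} := by
      rw [closure_circleFn_neg h']; exact hpm.2
    obtain ⟨z, hz1, hz2⟩ := mem_closure_iff.1 hcl _ (isOpen_circleFn_neg a b e c) hlt
    exact hdisj z hz1 hz2
  have h0' : circleFn a' b' e' c' p = 0 := by
    refine le_antisymm hpm.2 (not_lt.1 fun hlt => ?_)
    have hcl : p ∈ closure {z | circleFn a b e c z < 0} := by
      rw [closure_circleFn_neg h]; exact hpm.1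
    obtain ⟨z, hz1, hz2⟩ := mem_closure_iff.1 hcl _ (isOpen_circleFn_neg a' b' e' c') hlt
    exact hdisj z hz2 hz1
  set m := b * b' + e * e' - (a * c' + a' * c) / 2 with hm
  simp only [circleFn] at h0 h0'
  have hn : (a * p.re - b) ^ 2 + (a * p.im - e) ^ 2 = 1 := by linear_combination a * h0 + h
  have hn' : (a' * p.re - b') ^ 2 + (a' * p.im - e') ^ 2 = 1 := by
    linear_combination a' * h0' + h'
  have hnn : (a * p.re - b) * (a' * p.re - b') + (a * p.im - e) * (a' * p.im - e') = m := by
    rw [hm]; linear_combination a' / 2 * h0 + a / 2 * h0'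
  by_contra hne
  have hm1 : 0 < 1 + m := by
    have : 0 ≤ 1 + m := by
      nlinarith [sq_nonneg ((a * p.re - b) + (a' * p.re - b')),
        sq_nonneg ((a * p.im - e) + (a' * p.im - e'))]
    rcases this.lt_or_eq with h1 | h1
    · exact h1
    · exact absurd (by linarith) hne
  set t := 1 / (a + a' + 1) with ht
  have htp : 0 < t := by positivity
  have hat : a * t < 1 := by rw [ht, mul_one_div, div_lt_one (by positivity)]; linarith
  have hat' : a' * t < 1 := by rw [ht, mul_one_div, div_lt_one (by positivity)]; linarith
  have hprod : 0 < t * (1 + m) := mul_pos htp hm1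
  refine hdisj ⟨p.re - t * ((a * p.re - b) + (a' * p.re - b')),
    p.im - t * ((a * p.im - e) + (a' * p.im - e'))⟩ ?_ ?_
  · have : circleFn a b e c ⟨p.re - t * ((a * p.re - b) + (a' * p.re - b')),
        p.im - t * ((a * p.im - e) + (a' * p.im - e'))⟩ = 2 * (t * (1 + m)) * (a * t - 1) := by
      simp only [circleFn]
      linear_combination h0 + (a * t ^ 2 - 2 * t) * hn + a * t ^ 2 * hn' +
        (2 * a * t ^ 2 - 2 * t) * hnn
    rw [this]; nlinarith
  · have : circleFn a' b' e' c' ⟨p.re - t * ((a * p.re - b) + (a' * p.re - b')),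
        p.im - t * ((a * p.im - e) + (a' * p.im - e'))⟩ = 2 * (t * (1 + m)) * (a' * t - 1) := by
      simp only [circleFn]
      linear_combination h0' + (a' * t ^ 2 - 2 * t) * hn' + a' * t ^ 2 * hn +
        (2 * a' * t ^ 2 - 2 * t) * hnn
    rw [this]; nlinarith

/-- The sum of the functions of two externally tangent generalized disks is a multiple of the
squared distance to the tangency point. -/
theorem circleFn_add_of_gram {a b e c a' b' e' c' : ℝ} (haa : 0 < a + a')
    (h : b ^ 2 + e ^ 2 - a * c = 1) (h' : b' ^ 2 + e' ^ 2 - a' * c' = 1)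
    (hg : b * b' + e * e' - (a * c' + a' * c) / 2 = -1) (z : ℂ) :
    circleFn a b e c z + circleFn a' b' e' c' z =
      (a + a') * ((z.re - (b + b') / (a + a')) ^ 2 + (z.im - (e + e') / (a + a')) ^ 2) := by
  simp only [circleFn]
  field_simp
  linear_combination -h - h' - 2 * hg

/-- Externally tangent generalized disks have closures meeting exactly in the tangency point. -/
theorem inter_eq_singleton_of_gram {a b e c a' b' e' c' : ℝ} (haa : 0 < a + a')
    (h : b ^ 2 + e ^ 2 - a * c = 1) (h' : b' ^ 2 + e' ^ 2 - a' * c' = 1)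
    (hg : b * b' + e * e' - (a * c' + a' * c) / 2 = -1) :
    {z | circleFn a b e c z ≤ 0} ∩ {z | circleFn a' b' e' c' z ≤ 0} =
      {⟨(b + b') / (a + a'), (e + e') / (a + a')⟩} := by
  ext z
  simp only [Set.mem_inter_iff, Set.mem_ofPred_eq, Set.mem_singleton_iff]
  constructor
  · rintro ⟨h1, h2⟩
    have h3 := circleFn_add_of_gram haa h h' hg z
    have h4 : (z.re - (b + b') / (a + a')) ^ 2 + (z.im - (e + e') / (a + a')) ^ 2 ≤ 0 := by
      by_contra hcon
      have := mul_pos haa (not_le.1 hcon)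
      linarith
    have h5 : z.re - (b + b') / (a + a') = 0 := by
      apply pow_eq_zero_iff (two_ne_zero) |>.1
      nlinarith [sq_nonneg (z.re - (b + b') / (a + a')), sq_nonneg (z.im - (e + e') / (a + a'))]
    have h6 : z.im - (e + e') / (a + a') = 0 := by
      apply pow_eq_zero_iff (two_ne_zero) |>.1
      nlinarith [sq_nonneg (z.re - (b + b') / (a + a')), sq_nonneg (z.im - (e + e') / (a + a'))]
    apply Complex.ext
    · simpa using sub_eq_zero.1 h5
    · simpa using sub_eq_zero.1 h6
  · rintro rfl
    constructor
    · apply le_of_eq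
      simp only [circleFn]
      field_simp
      linear_combination (-a - 2*a') * h + a * h' - 2 * a' * hg
    · apply le_of_eq
      simp only [circleFn]
      field_simp
      linear_combination (-a' - 2*a) * h' + a' * h - 2 * a * hg

/-- A generalized disk of positive curvature is a round disk. -/
theorem circleFn_neg_eq_ball {a b e c : ℝ} (ha : 0 < a) (h : b ^ 2 + e ^ 2 - a * c = 1) :
    {z | circleFn a b e c z < 0} = Metric.ball (⟨b / a, e / a⟩ : ℂ) a⁻¹ := by
  ext z
  rw [Set.mem_ofPred_eq, Metric.mem_ball, Complex.dist_eq_re_im,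
    Real.sqrt_lt' (by positivity : 0 < a⁻¹)]
  have : circleFn a b e c z = a * ((z.re - b / a) ^ 2 + (z.im - e / a) ^ 2 - a⁻¹ ^ 2) := by
    simp only [circleFn]; field_simp; linear_combination -h
  rw [this]
  constructor
  · intro h1
    by_contra h2
    exact absurd h1 (not_lt.2 (mul_nonneg ha.le (by simpa using sub_nonneg.2 (not_lt.1 h2))))
  · intro h1
    exact mul_neg_of_pos_of_neg ha (by simpa using sub_neg.2 h1)

theorem ball_radius_inj {z z' : ℂ} {r r' : ℝ} (hr : 0 < r) (hr' : 0 < r')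
    (h : Metric.ball z r = Metric.ball z' r') : r = r' := by
  have h1 := congrArg Metric.diam h
  rw [Metric.diam_ball_eq, Metric.diam_ball_eq] at h1 <;> linarith

theorem curv_ball (z : ℂ) {r : ℝ} (hr : 0 < r) : curv (Metric.ball z r) = r⁻¹ := by
  have hd : IsOpenDisk (Metric.ball z r) := ⟨z, r, hr, rfl⟩
  have hex : ∃ s : ℝ, 0 < s ∧ ∃ w : ℂ, Metric.ball z r = Metric.ball w s := ⟨r, hr, z, rfl⟩
  have hs := Classical.epsilon_spec hex
  obtain ⟨h1, w, h2⟩ := hs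
  rw [curv, if_pos hd, diskRadius, ← ball_radius_inj hr h1 h2]

theorem circleFn_zero_neg_not_isOpenDisk {b e c : ℝ} (h : b ^ 2 + e ^ 2 = 1) :
    ¬ IsOpenDisk {z | circleFn 0 b e c z < 0} := by
  rintro ⟨z, r, hr, h1⟩
  obtain ⟨R, hR⟩ := (h1 ▸ Metric.isBounded_ball : Bornology.IsBounded
    {z | circleFn 0 b e c z < 0}).exists_norm_le
  set t := |c| + |R| + 1 with ht
  have hmem : (⟨t * b, t * e⟩ : ℂ) ∈ {z | circleFn 0 b e c z < 0} := by
    simp only [circleFn, Set.mem_ofPred_eq]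
    have : 0 * ((t * b) ^ 2 + (t * e) ^ 2) - 2 * b * (t * b) - 2 * e * (t * e) + c
      = c - 2 * t := by linear_combination -2 * t * h
    rw [this]
    linarith [le_abs_self c, abs_nonneg c, abs_nonneg R]
  have h2 := hR _ hmem
  have h3 : ‖(⟨t * b, t * e⟩ : ℂ)‖ = t := by
    rw [Complex.norm_eq_sqrt_sq_add_sq]
    have : (t * b) ^ 2 + (t * e) ^ 2 = t ^ 2 := by linear_combination t ^ 2 * h
    rw [this, Real.sqrt_sq (by positivity)]
  rw [h3] at h2
  linarith [le_abs_self R, abs_nonneg c]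

theorem curv_circleFn_neg {a b e c : ℝ} (ha : 0 ≤ a) (h : b ^ 2 + e ^ 2 - a * c = 1) :
    curv {z | circleFn a b e c z < 0} = a := by
  rcases ha.lt_or_eq with ha | rfl
  · rw [circleFn_neg_eq_ball ha h, curv_ball _ (by positivity), inv_inv]
  · rw [curv, if_neg (circleFn_zero_neg_not_isOpenDisk (by linarith))]

theorem IsOpenDisk.exists_circleFn {D : Set ℂ} (hD : IsOpenDisk D) :
    ∃ a b e c : ℝ, 0 < a ∧ b ^ 2 + e ^ 2 - a * c = 1 ∧ D = {z | circleFn a b e c z < 0} := by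
  obtain ⟨z, r, hr, rfl⟩ := hD
  have h : (z.re / r) ^ 2 + (z.im / r) ^ 2 - r⁻¹ * ((z.re ^ 2 + z.im ^ 2 - r ^ 2) / r) = 1 := by
    field_simp; ring
  refine ⟨r⁻¹, z.re / r, z.im / r, (z.re ^ 2 + z.im ^ 2 - r ^ 2) / r, by positivity, h, ?_⟩
  rw [circleFn_neg_eq_ball (by positivity) h, inv_inv]
  congr 1
  apply Complex.ext <;> field_simp

theorem IsOpenHalfPlane.exists_circleFn {D : Set ℂ} (hD : IsOpenHalfPlane D) :
    ∃ b e c : ℝ, b ^ 2 + e ^ 2 = 1 ∧ D = {z | circleFn 0 b e c z < 0} := by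
  obtain ⟨a, ha, c, rfl⟩ := hD
  have hn : 0 < ‖a‖ := norm_pos_iff.2 ha
  have hsq : a.re ^ 2 + a.im ^ 2 = ‖a‖ ^ 2 := by
    rw [Complex.sq_norm, Complex.normSq_apply]; ring
  refine ⟨-a.re / ‖a‖, a.im / ‖a‖, -2 * c / ‖a‖, ?_, ?_⟩
  · field_simp; linarith
  · ext z
    have : circleFn 0 (-a.re / ‖a‖) (a.im / ‖a‖) (-2 * c / ‖a‖) z =
        2 / ‖a‖ * ((a * z).re - c) := by
      simp only [circleFn, Complex.mul_re]; field_simp; ring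
    rw [Set.mem_ofPred_eq, Set.mem_ofPred_eq, this]
    have h2 : 0 < 2 / ‖a‖ := by positivity
    constructor
    · intro h; exact mul_neg_of_pos_of_neg h2 (by linarith)
    · intro h
      by_contra hcon
      exact absurd h (not_lt.2 (mul_nonneg h2.le (by linarith)))

theorem isOpenHalfPlane_circleFn {b e c : ℝ} (h : b ^ 2 + e ^ 2 = 1) :
    IsOpenHalfPlane {z | circleFn 0 b e c z < 0} := by
  refine ⟨⟨-b, e⟩, ?_, -c / 2, ?_⟩
  · intro h0
    have h1 := congrArg Complex.re h0
    have h2 := congrArg Complex.im h0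
    simp only [Complex.zero_re, Complex.zero_im, neg_eq_zero] at h1 h2
    rw [h1, h2] at h; norm_num at h
  · ext z
    simp only [Set.mem_ofPred_eq, circleFn, Complex.mul_re]
    constructor <;> intro h <;> linarith

/-- The Lorentzian bilinear form on the coordinate space `ℝ⁴`, normalized so that it computes
squared distances between points. -/
noncomputable def ell (x g : Fin 4 → ℝ) : ℝ :=
  (x 0 * (g 1 + g 2) + x 1 * (g 0 + g 2) + x 2 * (g 0 + g 1)) / 4 - x 3 * g 3 / 2

theorem ell_comm (x g : Fin 4 → ℝ) : ell x g = ell g x := by unfold ell; ring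

/-- The Gram matrix of three mutually tangent disks and their common orthogonal disk. -/
def gramMat : Matrix (Fin 4) (Fin 4) ℝ :=
  !![1, -1, -1, 0; -1, 1, -1, 0; -1, -1, 1, 0; 0, 0, 0, 1]

/-- The relations dual to the Gram relations. -/
structure IsDualFrame (a b e c : Fin 4 → ℝ) : Prop where
  aa : ell a a = 0
  ab : ell a b = 0
  ae : ell a e = 0
  ac : ell a c = 1
  bb : ell b b = -1 / 2
  be : ell b e = 0
  bc : ell b c = 0
  ee : ell e e = -1 / 2
  ec : ell e c = 0
  cc : ell c c = 0

set_option maxHeartbeats 1000000 in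
theorem isDualFrame_of_gram {a b e c : Fin 4 → ℝ}
    (h : ∀ i j, b i * b j + e i * e j - (a i * c j + a j * c i) / 2 = gramMat i j) :
    IsDualFrame a b e c := by
  let R : Matrix (Fin 4) (Fin 4) ℝ := Matrix.of ![a, b, e, c]
  let J : Matrix (Fin 4) (Fin 4) ℝ := !![0, 0, 0, -1/2; 0, 1, 0, 0; 0, 0, 1, 0; -1/2, 0, 0, 0]
  let Q' : Matrix (Fin 4) (Fin 4) ℝ :=
    !![0, -1/2, -1/2, 0; -1/2, 0, -1/2, 0; -1/2, -1/2, 0, 0; 0, 0, 0, 1]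
  have hQ : gramMat * Q' = 1 := by
    ext i j
    simp only [Matrix.mul_apply, Fin.sum_univ_four]
    fin_cases i <;> fin_cases j <;> simp [gramMat, Q'] <;> norm_num
  have h1 : Rᵀ * J * R = gramMat := by
    ext i j
    rw [← h i j]
    simp only [Matrix.mul_apply, Matrix.transpose_apply, Fin.sum_univ_four]
    simp [R, J]
    ring
  have h2 : Rᵀ * (J * R * Q') = 1 := by
    rw [← hQ, ← h1]; simp only [Matrix.mul_assoc]
  have h3 := mul_eq_one_comm.1 h2
  have key : ∀ i j, (J * R * Q' * Rᵀ) i j = (1 : Matrix (Fin 4) (Fin 4) ℝ) i j := fun i j => by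
    rw [h3]
  simp only [Matrix.mul_apply, Matrix.transpose_apply, Fin.sum_univ_four] at key
  have k00 := key 0 0
  have k01 := key 0 1
  have k02 := key 0 2
  have k03 := key 0 3
  have k11 := key 1 1
  have k12 := key 1 2
  have k22 := key 2 2
  have k30 := key 3 0
  have k31 := key 3 1
  have k32 := key 3 2
  simp [R, J, Q'] at k00 k01 k02 k03 k11 k12 k22 k30 k31 k32
  clear key h1 h2 h3 hQ h
  constructor <;> simp only [ell]
  · linear_combination k30
  · linear_combination k31
  · linear_combination k32
  · linear_combination k00
  · linear_combination -1 / 2 * k11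
  · linear_combination -1 / 2 * k12
  · linear_combination k01
  · linear_combination -1 / 2 * k22
  · linear_combination k02
  · linear_combination k03

theorem IsDualFrame.expand {a b e c : Fin 4 → ℝ} (h : IsDualFrame a b e c) (y : Fin 4 → ℝ)
    (j : Fin 4) :
    y j = ell y c * a j - 2 * ell y b * b j - 2 * ell y e * e j + ell y a * c j := by
  let R : Matrix (Fin 4) (Fin 4) ℝ := Matrix.of ![a, b, e, c]
  let E : Matrix (Fin 4) (Fin 4) ℝ :=
    !![0, 1/4, 1/4, 0; 1/4, 0, 1/4, 0; 1/4, 1/4, 0, 0; 0, 0, 0, -1/2]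
  let N : Matrix (Fin 4) (Fin 4) ℝ := !![0, 0, 0, 1; 0, -2, 0, 0; 0, 0, -2, 0; 1, 0, 0, 0]
  obtain ⟨aa, ab, ae, ac, bb, be, bc, ee, ec, cc⟩ := h
  have h1 : R * (E * Rᵀ * N) = 1 := by
    simp only [ell] at *
    ext i j
    simp only [Matrix.mul_apply, Matrix.transpose_apply, Fin.sum_univ_four]
    fin_cases i <;> fin_cases j <;> simp [R, E, N] <;> linarith
  have h2 := mul_eq_one_comm.1 h1
  have h3 : (y ᵥ* (E * Rᵀ * N * R)) j = y j := by rw [h2, Matrix.vecMul_one]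
  simp only [Matrix.vecMul, dotProduct, Matrix.mul_apply, Matrix.transpose_apply,
    Fin.sum_univ_four] at h3
  simp [R, E, N] at h3
  rw [← h3]
  simp only [ell]
  ring

theorem IsDualFrame.gram {a b e c : Fin 4 → ℝ} (h : IsDualFrame a b e c) (i j : Fin 4) :
    b i * b j + e i * e j - (a i * c j + a j * c i) / 2 = gramMat i j := by
  have key := h.expand (-2 * gramMat i) j
  have hp : ∀ g : Fin 4 → ℝ, ell (-2 * gramMat i) g = g i := by
    intro g
    fin_cases i <;> simp [ell, gramMat] <;> ring
  rw [hp, hp, hp, hp] at key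
  simp at key
  linarith

theorem IsDualFrame.ell_comb {a b e c : Fin 4 → ℝ} (h : IsDualFrame a b e c)
    {x y : Fin 4 → ℝ} {s t u v s' t' u' v' : ℝ}
    (hx : ∀ i, x i = s * a i + t * b i + u * e i + v * c i)
    (hy : ∀ i, y i = s' * a i + t' * b i + u' * e i + v' * c i) :
    ell x y = s * v' + v * s' - (t * t' + u * u') / 2 := by
  obtain ⟨aa, ab, ae, ac, bb, be, bc, ee, ec, cc⟩ := h
  simp only [ell] at *
  simp only [hx, hy]
  linear_combination s * s' * aa + (s * t' + t * s') * ab + (s * u' + u * s') * ae +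
    (s * v' + v * s') * ac + t * t' * bb + (t * u' + u * t') * be + (t * v' + v * t') * bc +
    u * u' * ee + (u * v' + v * u') * ec + v * v' * cc

/-- Data of three mutually tangent generalized disks and the disk orthogonal to them: the
coefficients of their four defining functions. -/
structure Frame where
  a : Fin 4 → ℝ
  b : Fin 4 → ℝ
  e : Fin 4 → ℝ
  c : Fin 4 → ℝ
  dual : IsDualFrame a b e c
  a0 : 0 ≤ a 0
  a1 : 0 ≤ a 1
  a2 : 0 ≤ a 2
  a3 : 0 < a 3

namespace Frame

/-- The values at `z` of the four defining functions. -/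
def coord (F : Frame) (z : ℂ) : Fin 4 → ℝ := fun i => circleFn (F.a i) (F.b i) (F.e i) (F.c i) z

/-- The point with given homogeneous coordinates. -/
noncomputable def point (F : Frame) (x : Fin 4 → ℝ) : ℂ := ⟨ell x F.b / ell x F.a, ell x F.e / ell x F.a⟩

/-- `F` describes the disk triple `𝒟`. -/
def Describes (F : Frame) (𝒟 : Fin 3 → Set ℂ) : Prop :=
  ∀ j : Fin 3, 𝒟 j = {z | F.coord z j.castSucc < 0}

variable (F : Frame)

theorem coord_eq (z : ℂ) (i : Fin 4) : F.coord z i =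
    (z.re ^ 2 + z.im ^ 2) * F.a i + (-2 * z.re) * F.b i + (-2 * z.im) * F.e i + 1 * F.c i := by
  simp only [coord, circleFn]; ring

theorem ell_coord_coord (z w : ℂ) : ell (F.coord z) (F.coord w) = dist z w ^ 2 := by
  rw [F.dual.ell_comb (F.coord_eq z) (F.coord_eq w), Complex.dist_eq_re_im,
    Real.sq_sqrt (by positivity)]
  ring

theorem ell_coord_self (z : ℂ) : ell (F.coord z) (F.coord z) = 0 := by
  rw [ell_coord_coord, dist_self]; norm_num

theorem ell_coord_a (z : ℂ) : ell (F.coord z) F.a = 1 := by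
  rw [F.dual.ell_comb (F.coord_eq z) (s' := 1) (t' := 0) (u' := 0) (v' := 0)
    (fun i => by ring)]
  ring

theorem point_coord (z : ℂ) : F.point (F.coord z) = z := by
  have hb : ell (F.coord z) F.b = z.re := by
    rw [F.dual.ell_comb (F.coord_eq z) (s' := 0) (t' := 1) (u' := 0) (v' := 0)
      (fun i => by ring)]
    ring
  have he : ell (F.coord z) F.e = z.im := by
    rw [F.dual.ell_comb (F.coord_eq z) (s' := 0) (t' := 0) (u' := 1) (v' := 0)
      (fun i => by ring)]
    ring
  apply Complex.ext <;> simp [point, ell_coord_a, hb, he]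

theorem coord_point {x : Fin 4 → ℝ} (hx : ell x x = 0) (h : ell x F.a ≠ 0) (i : Fin 4) :
    F.coord (F.point x) i = x i / ell x F.a := by
  have hexp : ∀ j, x j = ell x F.c * F.a j + (-2 * ell x F.b) * F.b j +
      (-2 * ell x F.e) * F.e j + ell x F.a * F.c j := fun j => by
    rw [F.dual.expand x j]; ring
  have hn := F.dual.ell_comb hexp hexp
  rw [hx] at hn
  rw [eq_div_iff h, coord_eq, hexp i]
  simp only [point]
  field_simp
  linear_combination (F.a i / 2) * hn

theorem continuous_coord (i : Fin 4) : Continuous fun z => F.coord z i :=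
  continuous_circleFn _ _ _ _

theorem gram (i j : Fin 4) :
    F.b i * F.b j + F.e i * F.e j - (F.a i * F.c j + F.a j * F.c i) / 2 = gramMat i j :=
  F.dual.gram i j

theorem norm_eq (i : Fin 4) : F.b i ^ 2 + F.e i ^ 2 - F.a i * F.c i = 1 := by
  have h := F.gram i i
  have : gramMat i i = 1 := by fin_cases i <;> rfl
  rw [this] at h
  linarith

theorem a_sq : F.a 3 ^ 2 = F.a 0 * F.a 1 + F.a 1 * F.a 2 + F.a 2 * F.a 0 := by
  have := F.dual.aa
  simp only [ell] at this
  linarith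

theorem coord_sq (z : ℂ) : F.coord z 3 ^ 2 = F.coord z 0 * F.coord z 1 +
    F.coord z 1 * F.coord z 2 + F.coord z 2 * F.coord z 0 := by
  have := F.ell_coord_self z
  simp only [ell] at this
  linarith

theorem a_nonneg (j : Fin 3) : 0 ≤ F.a j.castSucc := by
  fin_cases j
  exacts [F.a0, F.a1, F.a2]

theorem a_add_pos {j k : Fin 3} (hjk : j ≠ k) : 0 < F.a j.castSucc + F.a k.castSucc := by
  have h := F.a_sq
  have h3 : 0 < F.a 3 ^ 2 := pow_pos F.a3 2
  have h0 := F.a0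
  have h1 := F.a1
  have h2 := F.a2
  have h01 : 0 < F.a 0 + F.a 1 := by
    by_contra hc
    have e0 : F.a 0 = 0 := by linarith
    have e1 : F.a 1 = 0 := by linarith
    simp [e0, e1] at h; linarith [F.a3]
  have h12 : 0 < F.a 1 + F.a 2 := by
    by_contra hc
    have e0 : F.a 1 = 0 := by linarith
    have e1 : F.a 2 = 0 := by linarith
    simp [e0, e1] at h; linarith [F.a3]
  have h20 : 0 < F.a 2 + F.a 0 := by
    by_contra hc
    have e0 : F.a 2 = 0 := by linarith
    have e1 : F.a 0 = 0 := by linarith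
    simp [e0, e1] at h; linarith [F.a3]
  fin_cases j <;> fin_cases k <;> first | exact absurd rfl hjk | (simp; linarith)

theorem gram_ne {j k : Fin 3} (hjk : j ≠ k) :
    F.b j.castSucc * F.b k.castSucc + F.e j.castSucc * F.e k.castSucc -
      (F.a j.castSucc * F.c k.castSucc + F.a k.castSucc * F.c j.castSucc) / 2 = -1 := by
  rw [F.gram]
  fin_cases j <;> fin_cases k <;> first | exact absurd rfl hjk | rfl

end Frame

/-- Three mutually tangent generalized disks, not all of them degenerate, extend to a frame. -/
theorem exists_frame {a b e c : Fin 3 → ℝ} (ha : ∀ j, 0 ≤ a j)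
    (hn : ∀ j, b j ^ 2 + e j ^ 2 - a j * c j = 1)
    (hg : ∀ j k, j ≠ k → b j * b k + e j * e k - (a j * c k + a k * c j) / 2 = -1)
    (hpos : 0 < a 0 * a 1 + a 1 * a 2 + a 2 * a 0) :
    ∃ F : Frame, ∀ j : Fin 3, F.a j.castSucc = a j ∧ F.b j.castSucc = b j ∧
      F.e j.castSucc = e j ∧ F.c j.castSucc = c j := by
  let D : (Fin 3 → ℝ) → (Fin 3 → ℝ) → (Fin 3 → ℝ) → ℝ := fun r s t =>
    r 0 * (s 1 * t 2 - s 2 * t 1) - r 1 * (s 0 * t 2 - s 2 * t 0) +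
      r 2 * (s 0 * t 1 - s 1 * t 0)
  let na := -D a b e / 2
  let nb := D a e c / 4
  let ne := -D a b c / 4
  let nc := D b e c / 2
  have hnn : nb ^ 2 + ne ^ 2 - na * nc = 1 := by
    let G : Fin 3 → Fin 3 → ℝ := fun j k => b j * b k + e j * e k - (a j * c k + a k * c j) / 2
    have h1 : nb ^ 2 + ne ^ 2 - na * nc = -1 / 4 *
        (G 0 0 * (G 1 1 * G 2 2 - G 1 2 * G 1 2) - G 0 1 * (G 0 1 * G 2 2 - G 1 2 * G 0 2) +
          G 0 2 * (G 0 1 * G 1 2 - G 1 1 * G 0 2)) := by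
      simp only [na, nb, ne, nc, D, G]; ring
    have hG : ∀ j, G j j = 1 := fun j => by have := hn j; simp only [G]; linarith
    rw [h1, hG, hG, hG, show G 0 1 = -1 from hg 0 1 (by decide),
      show G 0 2 = -1 from hg 0 2 (by decide), show G 1 2 = -1 from hg 1 2 (by decide)]
    norm_num
  have horth : ∀ j, b j * nb + e j * ne - (a j * nc + na * c j) / 2 = 0 := by
    intro j
    fin_cases j <;> simp only [na, nb, ne, nc, D] <;> simp <;> ring
  have hdual : ∀ s : ℝ, s ^ 2 = 1 → IsDualFrame ![a 0, a 1, a 2, s * na] ![b 0, b 1, b 2, s * nb]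
      ![e 0, e 1, e 2, s * ne] ![c 0, c 1, c 2, s * nc] := by
    intro s hs
    apply isDualFrame_of_gram
    have n0 := hn 0
    have n1 := hn 1
    have n2 := hn 2
    have g01 := hg 0 1 (by decide)
    have g02 := hg 0 2 (by decide)
    have g12 := hg 1 2 (by decide)
    have o0 := horth 0
    have o1 := horth 1
    have o2 := horth 2
    clear_value na nb ne nc
    intro i j
    fin_cases i <;> fin_cases j <;> simp [gramMat] <;>
      first
      | linarith
      | linear_combination s * o0
      | linear_combination s * o1
      | linear_combination s * o2
      | linear_combination hnn * s ^ 2 + hs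
  have hna : na ≠ 0 := by
    intro h0
    have := (hdual 1 (by norm_num)).aa
    simp [ell, h0] at this
    linarith
  obtain ⟨s, hs, hsp⟩ : ∃ s : ℝ, s ^ 2 = 1 ∧ 0 < s * na := by
    rcases lt_or_gt_of_ne hna with h | h
    · exact ⟨-1, by norm_num, by linarith⟩
    · exact ⟨1, by norm_num, by linarith⟩
  refine ⟨⟨_, _, _, _, hdual s hs, ha 0, ha 1, ha 2, hsp⟩, fun j => ?_⟩
  fin_cases j <;> simp

namespace Frame

variable (F : Frame)

/-- The triangular region between the three generalized disks of a frame. -/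
def tri : Set ℂ :=
  {z | 0 < F.coord z 0 ∧ 0 < F.coord z 1 ∧ 0 < F.coord z 2 ∧ F.coord z 3 < 0}

theorem pair_pos : 0 < F.a 1 + F.a 2 ∧ 0 < F.a 0 + F.a 2 ∧ 0 < F.a 0 + F.a 1 :=
  ⟨F.a_add_pos (j := 1) (k := 2) (by decide), F.a_add_pos (j := 0) (k := 2) (by decide),
    F.a_add_pos (j := 0) (k := 1) (by decide)⟩

end Frame

theorem ell_pos {x g : Fin 4 → ℝ} (h0 : 0 ≤ x 0) (h1 : 0 ≤ x 1) (h2 : 0 ≤ x 2) (h3 : x 3 ≤ 0)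
    (hs : 0 < x 0 + x 1 + x 2) (g0 : 0 < g 1 + g 2) (g1 : 0 < g 0 + g 2) (g2 : 0 < g 0 + g 1)
    (g3 : 0 ≤ g 3) : 0 < ell x g := by
  have e0 := mul_nonneg h0 g0.le
  have e1 := mul_nonneg h1 g1.le
  have e2 := mul_nonneg h2 g2.le
  have e3 := mul_nonneg (neg_nonneg.2 h3) g3
  have : 0 < x 0 * (g 1 + g 2) + x 1 * (g 0 + g 2) + x 2 * (g 0 + g 1) := by
    rcases h0.lt_or_eq with h | h
    · have := mul_pos h g0; linarith
    · rcases h1.lt_or_eq with h' | h'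
      · have := mul_pos h' g1; linarith
      · have : 0 < x 2 := by linarith
        have := mul_pos this g2; linarith
  unfold ell
  linarith

namespace Frame

variable (F : Frame)

theorem isBounded_tri : Bornology.IsBounded F.tri := by
  have h := circleFn_neg_eq_ball F.a3 (F.norm_eq 3)
  refine (Metric.isBounded_ball (x := (⟨F.b 3 / F.a 3, F.e 3 / F.a 3⟩ : ℂ))
    (r := (F.a 3)⁻¹)).subset ?_
  rw [← h]
  exact fun z hz => hz.2.2.2

/-- The point of the triangle whose first three coordinates are proportional to given ones. -/
noncomputable def triPoint (x : Fin 3 → ℝ) : ℂ :=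
  F.point ![x 0, x 1, x 2, -Real.sqrt (x 0 * x 1 + x 1 * x 2 + x 2 * x 0)]

theorem ell_triVec_pos {x : Fin 3 → ℝ} (hx : ∀ i, 0 < x i) :
    0 < ell ![x 0, x 1, x 2, -Real.sqrt (x 0 * x 1 + x 1 * x 2 + x 2 * x 0)] F.a := by
  obtain ⟨p0, p1, p2⟩ := F.pair_pos
  have h0 := hx 0
  have h1 := hx 1
  have h2 := hx 2
  refine ell_pos ?_ ?_ ?_ ?_ ?_ p0 p1 p2 F.a3.le
  · exact h0.le
  · exact h1.le
  · exact h2.le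
  · exact neg_nonpos.2 (Real.sqrt_nonneg _)
  · show 0 < x 0 + x 1 + x 2
    positivity

theorem tri_eq_image : F.tri = F.triPoint '' {x | ∀ i, 0 < x i} := by
  ext z
  constructor
  · rintro ⟨h0, h1, h2, h3⟩
    refine ⟨![F.coord z 0, F.coord z 1, F.coord z 2], ?_, ?_⟩
    · intro i
      fin_cases i
      exacts [h0, h1, h2]
    · have hs : Real.sqrt (F.coord z 0 * F.coord z 1 + F.coord z 1 * F.coord z 2 +
          F.coord z 2 * F.coord z 0) = -F.coord z 3 := by
        rw [← F.coord_sq, ← neg_sq, Real.sqrt_sq (by linarith)]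
      have : (![F.coord z 0, F.coord z 1, F.coord z 2, F.coord z 3] : Fin 4 → ℝ) = F.coord z := by
        funext i; fin_cases i <;> rfl
      simp only [triPoint, Matrix.cons_val]
      rw [hs, neg_neg, this, point_coord]
  · rintro ⟨x, hx, rfl⟩
    have hpos := F.ell_triVec_pos hx
    have h0 : 0 < x 0 := hx 0
    have h1 : 0 < x 1 := hx 1
    have h2 : 0 < x 2 := hx 2
    have hnull : ell ![x 0, x 1, x 2, -Real.sqrt (x 0 * x 1 + x 1 * x 2 + x 2 * x 0)]
        ![x 0, x 1, x 2, -Real.sqrt (x 0 * x 1 + x 1 * x 2 + x 2 * x 0)] = 0 := by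
      have := Real.sq_sqrt (show 0 ≤ x 0 * x 1 + x 1 * x 2 + x 2 * x 0 by positivity)
      simp only [ell, Matrix.cons_val]
      linear_combination -1 / 2 * this
    have hc := F.coord_point hnull hpos.ne'
    refine ⟨?_, ?_, ?_, ?_⟩ <;> rw [triPoint, hc]
    · exact div_pos h0 hpos
    · exact div_pos h1 hpos
    · exact div_pos h2 hpos
    · refine div_neg_of_neg_of_pos (neg_lt_zero.2 (Real.sqrt_pos.2 ?_)) hpos
      positivity

theorem isPreconnected_tri : IsPreconnected F.tri := by
  rw [tri_eq_image]
  refine IsPreconnected.image ?_ _ ?_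
  · refine Convex.isPreconnected ?_
    intro x hx y hy s t hs ht hst i
    have h1 := hx i
    have h2 := hy i
    simp only [Pi.add_apply, Pi.smul_apply, smul_eq_mul]
    rcases hs.lt_or_eq with h | h
    · have := mul_pos h h1
      have := mul_nonneg ht h2.le
      linarith
    · have : t = 1 := by linarith
      subst this; rw [← h]; linarith
  · have hcont : ∀ g : Fin 4 → ℝ, Continuous fun x : Fin 3 → ℝ =>
        ell ![x 0, x 1, x 2, -Real.sqrt (x 0 * x 1 + x 1 * x 2 + x 2 * x 0)] g := by
      intro g
      simp only [ell, Matrix.cons_val]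
      fun_prop
    have hcl : Continuous fun p : ℝ × ℝ => (⟨p.1, p.2⟩ : ℂ) :=
      Complex.equivRealProdCLM.symm.continuous
    refine hcl.comp_continuousOn (f := fun x : Fin 3 → ℝ =>
      (ell ![x 0, x 1, x 2, -Real.sqrt (x 0 * x 1 + x 1 * x 2 + x 2 * x 0)] F.b /
        ell ![x 0, x 1, x 2, -Real.sqrt (x 0 * x 1 + x 1 * x 2 + x 2 * x 0)] F.a,
      ell ![x 0, x 1, x 2, -Real.sqrt (x 0 * x 1 + x 1 * x 2 + x 2 * x 0)] F.e /
        ell ![x 0, x 1, x 2, -Real.sqrt (x 0 * x 1 + x 1 * x 2 + x 2 * x 0)] F.a)) ?_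
    refine ContinuousOn.prodMk ?_ ?_
    · exact (hcont _).continuousOn.div (hcont _).continuousOn fun x hx =>
        (F.ell_triVec_pos hx).ne'
    · exact (hcont _).continuousOn.div (hcont _).continuousOn fun x hx =>
        (F.ell_triVec_pos hx).ne'

theorem tri_nonempty : F.tri.Nonempty := by
  rw [tri_eq_image]
  exact ⟨_, Set.mem_image_of_mem _ (show ∀ i, (0 : ℝ) < (fun _ : Fin 3 => 1) i from
    fun _ => one_pos)⟩

variable {F} {𝒟 : Fin 3 → Set ℂ}

theorem Describes.closure_eq (h : F.Describes 𝒟) (j : Fin 3) :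
    closure (𝒟 j) = {z | F.coord z j.castSucc ≤ 0} := by
  rw [h j]
  exact closure_circleFn_neg (F.norm_eq _)

theorem Describes.compl_eq (h : F.Describes 𝒟) : (⋃ j, closure (𝒟 j))ᶜ =
    {z | 0 < F.coord z 0 ∧ 0 < F.coord z 1 ∧ 0 < F.coord z 2} := by
  ext z
  simp only [h.closure_eq, Set.mem_compl_iff, Set.mem_iUnion, Set.mem_ofPred_eq, not_exists,
    not_le, Fin.forall_fin_succ, IsEmpty.forall_iff, and_true]
  rfl

theorem coord_three_ne_zero {z : ℂ} (h0 : 0 < F.coord z 0) (h1 : 0 < F.coord z 1)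
    (h2 : 0 < F.coord z 2) : F.coord z 3 ≠ 0 := by
  intro h3
  have h := F.coord_sq z
  have : 0 < F.coord z 0 * F.coord z 1 + F.coord z 1 * F.coord z 2 +
    F.coord z 2 * F.coord z 0 := by positivity
  rw [h3] at h
  norm_num at h
  linarith

theorem Describes.connectedComponentIn_eq (h : F.Describes 𝒟) {z : ℂ} (hz : z ∈ F.tri) :
    connectedComponentIn (⋃ j, closure (𝒟 j))ᶜ z = F.tri := by
  rw [h.compl_eq]
  have hzU : z ∈ {z | 0 < F.coord z 0 ∧ 0 < F.coord z 1 ∧ 0 < F.coord z 2} :=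
    ⟨hz.1, hz.2.1, hz.2.2.1⟩
  apply Set.Subset.antisymm
  · have hsub := connectedComponentIn_subset
      {z | 0 < F.coord z 0 ∧ 0 < F.coord z 1 ∧ 0 < F.coord z 2} z
    have key : connectedComponentIn
        {z | 0 < F.coord z 0 ∧ 0 < F.coord z 1 ∧ 0 < F.coord z 2} z ⊆ {z | F.coord z 3 < 0} := by
      refine IsPreconnected.subset_left_of_subset_union
        (isOpen_lt (F.continuous_coord 3) continuous_const)
        (isOpen_lt continuous_const (F.continuous_coord 3) : IsOpen {z | 0 < F.coord z 3})
        ?_ ?_ ?_ isPreconnected_connectedComponentIn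
      · rw [Set.disjoint_left]
        intro w h1 h2
        exact lt_asymm (show F.coord w 3 < 0 from h1) h2
      · intro w hw
        obtain ⟨h0, h1, h2⟩ := hsub hw
        exact lt_or_gt_of_ne (coord_three_ne_zero h0 h1 h2)
      · exact ⟨z, mem_connectedComponentIn hzU, hz.2.2.2⟩
    intro w hw
    obtain ⟨h0, h1, h2⟩ := hsub hw
    exact ⟨h0, h1, h2, key hw⟩
  · exact F.isPreconnected_tri.subset_connectedComponentIn hz
      fun w hw => ⟨hw.1, hw.2.1, hw.2.2.1⟩

/-- Moving away radially from the center of the orthogonal disk increases the coordinates. -/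
theorem coord_ray (z : ℂ) (t : ℝ) (j : Fin 3) :
    F.coord ((⟨F.b 3 / F.a 3, F.e 3 / F.a 3⟩ : ℂ) +
        t * (z - ⟨F.b 3 / F.a 3, F.e 3 / F.a 3⟩)) j.castSucc =
      t * F.coord z j.castSucc + (t - 1) * (F.a j.castSucc / F.a 3) * (F.coord z 3 +
        (t - 1) * F.a 3 * ((z.re - F.b 3 / F.a 3) ^ 2 + (z.im - F.e 3 / F.a 3) ^ 2)) := by
  have hg := F.gram j.castSucc 3
  have hz : gramMat j.castSucc 3 = 0 := by fin_cases j <;> rfl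
  rw [hz] at hg
  have hn := F.norm_eq 3
  have h3 := F.a3.ne'
  have hc : F.a j.castSucc * ((F.b 3 / F.a 3) ^ 2 + (F.e 3 / F.a 3) ^ 2) -
      2 * (F.b j.castSucc * (F.b 3 / F.a 3) + F.e j.castSucc * (F.e 3 / F.a 3)) +
      F.c j.castSucc = F.a j.castSucc / F.a 3 ^ 2 := by
    field_simp
    linear_combination F.a j.castSucc * hn - 2 * F.a 3 * hg
  have h3' : F.coord z 3 = F.a 3 * ((z.re - F.b 3 / F.a 3) ^ 2 + (z.im - F.e 3 / F.a 3) ^ 2) -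
      1 / F.a 3 := by
    simp only [coord, circleFn]
    field_simp
    linear_combination -hn
  rw [h3']
  simp only [coord, circleFn, Complex.add_re, Complex.add_im, Complex.mul_re, Complex.mul_im,
    Complex.sub_re, Complex.sub_im, Complex.ofReal_re, Complex.ofReal_im]
  set p := F.b 3 / F.a 3
  set q := F.e 3 / F.a 3
  have hr : (t - 1) * (F.a j.castSucc / F.a 3) * (F.a 3 * ((z.re - p) ^ 2 + (z.im - q) ^ 2) -
      1 / F.a 3 + (t - 1) * F.a 3 * ((z.re - p) ^ 2 + (z.im - q) ^ 2)) =
      (t - 1) * (F.a j.castSucc * t * ((z.re - p) ^ 2 + (z.im - q) ^ 2) -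
        F.a j.castSucc / F.a 3 ^ 2) := by
    field_simp; ring
  rw [hr, ← hc]
  ring

theorem not_isBounded_connectedComponentIn (h : F.Describes 𝒟) {z : ℂ}
    (h0 : 0 < F.coord z 0) (h1 : 0 < F.coord z 1) (h2 : 0 < F.coord z 2)
    (h3 : 0 < F.coord z 3) :
    ¬ Bornology.IsBounded (connectedComponentIn (⋃ j, closure (𝒟 j))ᶜ z) := by
  intro hb
  set p : ℂ := ⟨F.b 3 / F.a 3, F.e 3 / F.a 3⟩ with hp
  let f : ℝ → ℂ := fun t => p + t * (z - p)
  have hf : Continuous f := by fun_prop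
  have hray : ∀ t, 1 ≤ t → ∀ j : Fin 3, 0 < F.coord z j.castSucc →
      0 < F.coord (f t) j.castSucc := by
    intro t ht j hj
    have h4 := coord_ray (F := F) z t j
    rw [← hp] at h4
    rw [show f t = p + t * (z - p) from rfl, h4]
    have ha := F.a_nonneg j
    have ha3 := F.a3
    have : 0 ≤ t - 1 := by linarith
    positivity
  have hsub : f '' Set.Ici 1 ⊆ (⋃ j, closure (𝒟 j))ᶜ := by
    rw [h.compl_eq]
    rintro _ ⟨t, ht, rfl⟩
    exact ⟨hray t ht 0 h0, hray t ht 1 h1, hray t ht 2 h2⟩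
  have hz : z ∈ f '' Set.Ici 1 := ⟨1, Set.self_mem_Ici, by simp [f]⟩
  have hb' := hb.subset (((convex_Ici (1 : ℝ)).isPreconnected.image f
    hf.continuousOn).subset_connectedComponentIn hz hsub)
  obtain ⟨R, hR⟩ := hb'.exists_norm_le
  have hw : 0 < ‖z - p‖ := by
    rw [norm_pos_iff, sub_ne_zero]
    rintro rfl
    have hn := F.norm_eq 3
    have ha3 := F.a3
    have : F.coord ⟨F.b 3 / F.a 3, F.e 3 / F.a 3⟩ 3 = -1 / F.a 3 := by
      simp only [coord, circleFn]
      field_simp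
      linear_combination -hn
    rw [hp, this] at h3
    have : -1 / F.a 3 < 0 := div_neg_of_neg_of_pos (by norm_num) ha3
    linarith
  set t := (|R| + ‖p‖ + 1) / ‖z - p‖ + 1 with ht
  have ht1 : 1 ≤ t := by
    have : 0 ≤ (|R| + ‖p‖ + 1) / ‖z - p‖ := by positivity
    linarith
  have h4 := hR (f t) ⟨t, ht1, rfl⟩
  have h5 : ‖(t : ℂ) * (z - p)‖ ≤ ‖f t‖ + ‖p‖ := by
    have : (t : ℂ) * (z - p) = f t - p := by simp [f]
    rw [this]
    exact norm_sub_le _ _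
  rw [norm_mul, Complex.norm_real, Real.norm_of_nonneg (by linarith)] at h5
  have h6 : t * ‖z - p‖ = |R| + ‖p‖ + 1 + ‖z - p‖ := by
    rw [ht]; field_simp
  have := le_abs_self R
  linarith

theorem Describes.idealTriangle_eq (h : F.Describes 𝒟) : idealTriangle 𝒟 = F.tri := by
  have hex : ∃ T : Set ℂ, Bornology.IsBounded T ∧
      ∃ z ∈ (⋃ j, closure (𝒟 j))ᶜ, T = connectedComponentIn (⋃ j, closure (𝒟 j))ᶜ z := by
    obtain ⟨z, hz⟩ := F.tri_nonempty
    refine ⟨F.tri, F.isBounded_tri, z, ?_, (h.connectedComponentIn_eq hz).symm⟩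
    rw [h.compl_eq]
    exact ⟨hz.1, hz.2.1, hz.2.2.1⟩
  obtain ⟨hb, z, hz, hT⟩ := Classical.epsilon_spec hex
  rw [idealTriangle, hT]
  rw [hT] at hb
  rw [h.compl_eq] at hz
  obtain ⟨h0, h1, h2⟩ := hz
  rcases lt_or_gt_of_ne (coord_three_ne_zero h0 h1 h2) with h3 | h3
  · exact h.connectedComponentIn_eq ⟨h0, h1, h2, h3⟩
  · exact absurd hb (not_isBounded_connectedComponentIn h h0 h1 h2 h3)

end Frame

/-- The combination of the coordinates that describes the inscribed disk. -/
def inscr (v : Fin 4 → ℝ) : ℝ := v 0 + v 1 + v 2 + 2 * v 3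

namespace Frame

section

variable (F : Frame)

theorem inscr_coord (z : ℂ) : inscr (F.coord z) =
    circleFn (inscr F.a) (inscr F.b) (inscr F.e) (inscr F.c) z := by
  simp only [inscr, coord, circleFn]; ring

theorem gramMat_values : gramMat 0 0 = 1 ∧ gramMat 1 1 = 1 ∧ gramMat 2 2 = 1 ∧
    gramMat 3 3 = 1 ∧ gramMat 0 1 = -1 ∧ gramMat 0 2 = -1 ∧ gramMat 1 2 = -1 ∧
    gramMat 0 3 = 0 ∧ gramMat 1 3 = 0 ∧ gramMat 2 3 = 0 :=
  ⟨rfl, rfl, rfl, rfl, rfl, rfl, rfl, rfl, rfl, rfl⟩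

theorem gram_inscr (j : Fin 3) : inscr F.b * F.b j.castSucc + inscr F.e * F.e j.castSucc -
    (inscr F.a * F.c j.castSucc + F.a j.castSucc * inscr F.c) / 2 = -1 := by
  have h0 := F.gram 0 j.castSucc
  have h1 := F.gram 1 j.castSucc
  have h2 := F.gram 2 j.castSucc
  have h3 := F.gram 3 j.castSucc
  have hs : gramMat 0 j.castSucc + gramMat 1 j.castSucc + gramMat 2 j.castSucc +
      2 * gramMat 3 j.castSucc = -1 := by
    fin_cases j <;> simp [gramMat]
  simp only [inscr]
  linear_combination h0 + h1 + h2 + 2 * h3 + hs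

theorem norm_inscr : inscr F.b ^ 2 + inscr F.e ^ 2 - inscr F.a * inscr F.c = 1 := by
  obtain ⟨v00, v11, v22, v33, v01, v02, v12, v03, v13, v23⟩ := gramMat_values
  have h00 := F.gram 0 0
  have h11 := F.gram 1 1
  have h22 := F.gram 2 2
  have h33 := F.gram 3 3
  have h01 := F.gram 0 1
  have h02 := F.gram 0 2
  have h12 := F.gram 1 2
  have h03 := F.gram 0 3
  have h13 := F.gram 1 3
  have h23 := F.gram 2 3
  rw [v00] at h00
  rw [v11] at h11
  rw [v22] at h22
  rw [v33] at h33
  rw [v01] at h01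
  rw [v02] at h02
  rw [v12] at h12
  rw [v03] at h03
  rw [v13] at h13
  rw [v23] at h23
  simp only [inscr]
  linear_combination h00 + h11 + h22 + 4 * h33 + 2 * h01 + 2 * h02 + 2 * h12 + 4 * h03 +
    4 * h13 + 4 * h23

theorem inscr_a_pos : 0 < inscr F.a := by
  have := F.a0
  have := F.a1
  have := F.a2
  have := F.a3
  unfold inscr
  positivity

/-- The inscribed disk of the triangle of a frame. -/
def inDisk : Set ℂ := {z | inscr (F.coord z) < 0}

theorem inDisk_eq : F.inDisk =
    {z | circleFn (inscr F.a) (inscr F.b) (inscr F.e) (inscr F.c) z < 0} := by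
  simp only [inDisk, inscr_coord]

theorem coord_pos_of_mem_closure_inDisk {z : ℂ} (hz : inscr (F.coord z) < 0) (j : Fin 3) :
    0 < F.coord z j.castSucc := by
  have h1 : 0 < inscr F.a + F.a j.castSucc := by
    have := F.inscr_a_pos
    have := F.a_nonneg j
    linarith
  have h := circleFn_add_of_gram h1 F.norm_inscr (F.norm_eq j.castSucc) (F.gram_inscr j) z
  rw [← inscr_coord] at h
  have : 0 ≤ inscr (F.coord z) + circleFn (F.a j.castSucc) (F.b j.castSucc) (F.e j.castSucc)
      (F.c j.castSucc) z := by
    rw [h]; positivity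
  have h3 : F.coord z j.castSucc = circleFn (F.a j.castSucc) (F.b j.castSucc) (F.e j.castSucc)
      (F.c j.castSucc) z := rfl
  linarith

theorem inDisk_subset_tri : F.inDisk ⊆ F.tri := by
  intro z hz
  have hz : inscr (F.coord z) < 0 := hz
  have h0 : 0 < F.coord z 0 := F.coord_pos_of_mem_closure_inDisk hz 0
  have h1 : 0 < F.coord z 1 := F.coord_pos_of_mem_closure_inDisk hz 1
  have h2 : 0 < F.coord z 2 := F.coord_pos_of_mem_closure_inDisk hz 2
  refine ⟨h0, h1, h2, ?_⟩
  unfold inscr at hz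
  linarith

variable {F} {𝒟 : Fin 3 → Set ℂ}

theorem Describes.isInscribedDisk_inDisk (h : F.Describes 𝒟) : IsInscribedDisk 𝒟 F.inDisk := by
  refine ⟨?_, ?_, fun j => ?_⟩
  · rw [inDisk_eq, circleFn_neg_eq_ball F.inscr_a_pos F.norm_inscr]
    exact ⟨_, _, inv_pos.2 F.inscr_a_pos, rfl⟩
  · rw [h.idealTriangle_eq]
    exact F.inDisk_subset_tri
  · rw [inDisk_eq, closure_circleFn_neg F.norm_inscr, h.closure_eq]
    refine ⟨_, inter_eq_singleton_of_gram ?_ F.norm_inscr (F.norm_eq j.castSucc)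
      (F.gram_inscr j)⟩
    have := F.inscr_a_pos
    have := F.a_nonneg j
    linarith

theorem Describes.eq_inDisk (h : F.Describes 𝒟) {D : Set ℂ} (hD : IsInscribedDisk 𝒟 D) :
    D = F.inDisk := by
  obtain ⟨hdisk, hsub, hp⟩ := hD
  obtain ⟨a, b, e, c, ha, hn, rfl⟩ := IsOpenDisk.exists_circleFn hdisk
  have hg : ∀ j : Fin 3, b * F.b j.castSucc + e * F.e j.castSucc -
      (a * F.c j.castSucc + F.a j.castSucc * c) / 2 = -1 := by
    intro j
    obtain ⟨p, hp⟩ := hp j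
    rw [closure_circleFn_neg hn, h.closure_eq] at hp
    exact gram_of_inter_eq_singleton ha.le (F.a_nonneg j) hn (F.norm_eq _) hp
  set t := b * F.b 3 + e * F.e 3 - (a * F.c 3 + F.a 3 * c) / 2 with ht
  have hx : ∀ i, (![-1, -1, -1, t] : Fin 4 → ℝ) i =
      (-c / 2) * F.a i + b * F.b i + e * F.e i + (-a / 2) * F.c i := by
    intro i
    have g0 := hg 0
    have g1 := hg 1
    have g2 := hg 2
    fin_cases i
    · show -1 = _
      simp at g0 ⊢; linarith
    · show -1 = _
      simp at g1 ⊢; linarith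
    · show -1 = _
      simp at g2 ⊢; linarith
    · show t = _
      simp [ht]; ring
  have hxx := F.dual.ell_comb hx hx
  have hxa := F.dual.ell_comb hx (y := F.a) (s' := 1) (t' := 0) (u' := 0) (v' := 0)
    (fun i => by ring)
  have hxb := F.dual.ell_comb hx (y := F.b) (s' := 0) (t' := 1) (u' := 0) (v' := 0)
    (fun i => by ring)
  have hxe := F.dual.ell_comb hx (y := F.e) (s' := 0) (t' := 0) (u' := 1) (v' := 0)
    (fun i => by ring)
  have hxc := F.dual.ell_comb hx (y := F.c) (s' := 0) (t' := 0) (u' := 0) (v' := 1)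
    (fun i => by ring)
  simp only [ell, Matrix.cons_val] at hxx hxa hxb hxe hxc
  clear_value t
  have ht2 : (t - 2) * (t + 2) = 0 := by linear_combination -2 * hxx + hn
  rcases mul_eq_zero.1 ht2 with h2 | h2
  · have ht2 : t = 2 := by linarith
    subst ht2
    rw [inDisk_eq]
    have ea : a = inscr F.a := by simp only [inscr]; linarith
    have eb : b = inscr F.b := by simp only [inscr]; linarith
    have ee : e = inscr F.e := by simp only [inscr]; linarith
    have ec : c = inscr F.c := by simp only [inscr]; linarith
    rw [ea, eb, ee, ec]
  · exfalso
    have ht2 : t = -2 := by linarith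
    subst ht2
    have ea : a = F.a 0 + F.a 1 + F.a 2 - 2 * F.a 3 := by linarith
    have eb : b = F.b 0 + F.b 1 + F.b 2 - 2 * F.b 3 := by linarith
    have ee : e = F.e 0 + F.e 1 + F.e 2 - 2 * F.e 3 := by linarith
    have ec : c = F.c 0 + F.c 1 + F.c 2 - 2 * F.c 3 := by linarith
    obtain ⟨z, hz⟩ : {z | circleFn a b e c z < 0}.Nonempty := by
      rw [circleFn_neg_eq_ball ha hn]
      exact Metric.nonempty_ball.2 (inv_pos.2 ha)
    have hzt := hsub hz
    rw [h.idealTriangle_eq] at hzt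
    obtain ⟨h0, h1, h2, h3⟩ := hzt
    have hz : circleFn a b e c z < 0 := hz
    have : circleFn a b e c z = F.coord z 0 + F.coord z 1 + F.coord z 2 - 2 * F.coord z 3 := by
      rw [ea, eb, ee, ec]
      simp only [coord, circleFn]
      ring
    linarith

theorem Describes.Din_eq (h : F.Describes 𝒟) : Din 𝒟 = F.inDisk :=
  h.eq_inDisk (Classical.epsilon_spec ⟨_, h.isInscribedDisk_inDisk⟩)

end

end Frame

theorem vecMul_Mmat_zero (x : Fin 4 → ℝ) : x ᵥ* Mmat 0 =
    ![inscr x, x 1, x 2, x 1 + x 2 + x 3] := by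
  funext i
  fin_cases i <;> simp [Mmat, Matrix.vecMul, dotProduct, Fin.sum_univ_four, inscr]
  ring

theorem vecMul_Mmat_one (x : Fin 4 → ℝ) : x ᵥ* Mmat 1 =
    ![x 0, inscr x, x 2, x 0 + x 2 + x 3] := by
  funext i
  fin_cases i <;> simp [Mmat, Matrix.vecMul, dotProduct, Fin.sum_univ_four, inscr]
  ring

theorem vecMul_Mmat_two (x : Fin 4 → ℝ) : x ᵥ* Mmat 2 =
    ![x 0, x 1, inscr x, x 0 + x 1 + x 3] := by
  funext i
  fin_cases i <;> simp [Mmat, Matrix.vecMul, dotProduct, Fin.sum_univ_four, inscr]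
  ring

/-- Case analysis over the three matrices, in explicit form. -/
theorem Mmat_induction {P : (Fin 4 → ℝ) → (Fin 4 → ℝ) → Prop} (j : Fin 3) (x : Fin 4 → ℝ)
    (h0 : P x ![inscr x, x 1, x 2, x 1 + x 2 + x 3])
    (h1 : P x ![x 0, inscr x, x 2, x 0 + x 2 + x 3])
    (h2 : P x ![x 0, x 1, inscr x, x 0 + x 1 + x 3]) : P x (x ᵥ* Mmat j) := by
  fin_cases j
  · exact (vecMul_Mmat_zero x).symm ▸ h0
  · exact (vecMul_Mmat_one x).symm ▸ h1
  · exact (vecMul_Mmat_two x).symm ▸ h2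

theorem ell_vecMul_Mmat (j : Fin 3) (x g : Fin 4 → ℝ) :
    ell (x ᵥ* Mmat j) (g ᵥ* Mmat j) = ell x g := by
  fin_cases j
  · show ell (x ᵥ* Mmat 0) (g ᵥ* Mmat 0) = _
    rw [vecMul_Mmat_zero, vecMul_Mmat_zero]; simp only [ell, inscr, Matrix.cons_val]; ring
  · show ell (x ᵥ* Mmat 1) (g ᵥ* Mmat 1) = _
    rw [vecMul_Mmat_one, vecMul_Mmat_one]; simp only [ell, inscr, Matrix.cons_val]; ring
  · show ell (x ᵥ* Mmat 2) (g ᵥ* Mmat 2) = _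
    rw [vecMul_Mmat_two, vecMul_Mmat_two]; simp only [ell, inscr, Matrix.cons_val]; ring

theorem Mword_cons (j : Fin 3) (w : Word) : Mword (j :: w) = Mmat j * Mword w := by
  simp [Mword]

theorem vecMul_Mword_cons (x : Fin 4 → ℝ) (j : Fin 3) (w : Word) :
    x ᵥ* Mword (j :: w) = (x ᵥ* Mmat j) ᵥ* Mword w := by
  rw [Mword_cons, Matrix.vecMul_vecMul]

theorem vecMul_Mword_nil (x : Fin 4 → ℝ) : x ᵥ* Mword [] = x := by
  simp [Mword]

theorem vecMul_Mword_append (x : Fin 4 → ℝ) (v w : Word) :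
    x ᵥ* Mword (v ++ w) = (x ᵥ* Mword v) ᵥ* Mword w := by
  simp [Mword, Matrix.vecMul_vecMul]

theorem ell_vecMul_Mword (w : Word) (x g : Fin 4 → ℝ) :
    ell (x ᵥ* Mword w) (g ᵥ* Mword w) = ell x g := by
  induction w generalizing x g with
  | nil => simp only [vecMul_Mword_nil]
  | cons j w ih => rw [vecMul_Mword_cons, vecMul_Mword_cons, ih, ell_vecMul_Mmat]

/-- The parameter space, described by the Lorentzian form. -/
structure IsCurv (g : Fin 4 → ℝ) : Prop where
  zero : 0 ≤ g 0
  one : 0 ≤ g 1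
  two : 0 ≤ g 2
  three : 0 < g 3
  null : ell g g = 0

theorem IsCurv.vecMul_Mmat {g : Fin 4 → ℝ} (h : IsCurv g) (j : Fin 3) : IsCurv (g ᵥ* Mmat j) := by
  have hn : ell (g ᵥ* Mmat j) (g ᵥ* Mmat j) = 0 := by rw [ell_vecMul_Mmat, h.null]
  obtain ⟨h0, h1, h2, h3, -⟩ := h
  revert hn
  refine Mmat_induction (P := fun _ y => ell y y = 0 → IsCurv y) j g ?_ ?_ ?_ <;> intro hn <;>
    constructor <;> first | exact hn | (simp only [inscr, Matrix.cons_val]; positivity)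

theorem IsCurv.vecMul_Mword {g : Fin 4 → ℝ} (h : IsCurv g) (w : Word) :
    IsCurv (g ᵥ* Mword w) := by
  induction w generalizing g with
  | nil => rwa [vecMul_Mword_nil]
  | cons j w ih => rw [vecMul_Mword_cons]; exact ih (h.vecMul_Mmat j)

namespace Frame

theorem isCurv (F : Frame) : IsCurv F.a := ⟨F.a0, F.a1, F.a2, F.a3, F.dual.aa⟩

/-- The frame of the triple in which the `j`-th disk is replaced by the inscribed one. -/
def step (F : Frame) (j : Fin 3) : Frame where
  a := F.a ᵥ* Mmat j
  b := F.b ᵥ* Mmat j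
  e := F.e ᵥ* Mmat j
  c := F.c ᵥ* Mmat j
  dual := by
    obtain ⟨aa, ab, ae, ac, bb, be, bc, ee, ec, cc⟩ := F.dual
    constructor <;> rw [ell_vecMul_Mmat] <;> assumption
  a0 := (F.isCurv.vecMul_Mmat j).zero
  a1 := (F.isCurv.vecMul_Mmat j).one
  a2 := (F.isCurv.vecMul_Mmat j).two
  a3 := (F.isCurv.vecMul_Mmat j).three

theorem step_coord (F : Frame) (j : Fin 3) (z : ℂ) :
    (F.step j).coord z = F.coord z ᵥ* Mmat j := by
  funext i
  simp only [coord, circleFn, step, Matrix.vecMul, dotProduct, Fin.sum_univ_four]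
  ring

theorem Describes.step {F : Frame} {𝒟 : Fin 3 → Set ℂ} (h : F.Describes 𝒟) (j : Fin 3) :
    (F.step j).Describes (Phi j 𝒟) := by
  intro k
  simp only [step_coord]
  rw [Phi, h.Din_eq]
  fin_cases j
  all_goals
    fin_cases k
    all_goals
      simp only [Fin.reduceFinMk, vecMul_Mmat_zero, vecMul_Mmat_one, vecMul_Mmat_two]
      first
        | (rw [Function.update_of_ne (by decide), h]; rfl)
        | (rw [Function.update_self]; rfl)

/-- The frame reached after applying a word. -/
def word (F : Frame) : Word → Frame
  | [] => F
  | j :: w => (F.step j).word w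

theorem Describes.word {F : Frame} {𝒟 : Fin 3 → Set ℂ} (h : F.Describes 𝒟) (w : Word) :
    (F.word w).Describes (applyWord 𝒟 w) := by
  induction w generalizing F 𝒟 with
  | nil => exact h
  | cons j w ih => exact ih (h.step j)

theorem word_coord (F : Frame) (w : Word) (z : ℂ) :
    (F.word w).coord z = F.coord z ᵥ* Mword w := by
  induction w generalizing F with
  | nil => rw [vecMul_Mword_nil]; rfl
  | cons j w ih => rw [vecMul_Mword_cons, ← step_coord]; exact ih _

theorem Describes.AG_eq {F : Frame} {𝒟 : Fin 3 → Set ℂ} (h : F.Describes 𝒟) :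
    AG 𝒟 = {z | z ∈ closure F.tri ∧ ∀ w, 0 ≤ inscr (F.coord z ᵥ* Mword w)} := by
  ext z
  simp only [AG, h.idealTriangle_eq, Set.mem_sdiff, Set.mem_iUnion, not_exists,
    (h.word _).Din_eq, inDisk, word_coord, Set.mem_ofPred_eq, not_lt]

end Frame

theorem Frame.a_three_eq_of_null (F : Frame) {g : Fin 4 → ℝ} (hg : IsCurv g)
    (h0 : F.a 0 = g 0) (h1 : F.a 1 = g 1) (h2 : F.a 2 = g 2) : F.a = g := by
  have h := F.a_sq
  have hn := hg.null
  simp only [ell] at hn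
  have h3 : F.a 3 = g 3 := by
    have : (F.a 3 - g 3) * (F.a 3 + g 3) = 0 := by
      rw [h0, h1, h2] at h
      linear_combination h + 2 * hn
    rcases mul_eq_zero.1 this with h | h
    · linarith
    · linarith [F.a3, hg.three]
  funext i
  fin_cases i
  exacts [h0, h1, h2, h3]

/-- Every tangential disk triple is described by a frame. -/
theorem exists_frame_of_isTDT {𝒟 : Fin 3 → Set ℂ} (h : IsTDT 𝒟) :
    ∃ F : Frame, F.Describes 𝒟 ∧ ∀ j : Fin 3, F.a j.castSucc = curv (𝒟 j) := by
  obtain ⟨h, htan⟩ := h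
  have hex : ∀ j, ∃ a b e c : ℝ, 0 ≤ a ∧ (IsOpenDisk (𝒟 j) → 0 < a) ∧
      b ^ 2 + e ^ 2 - a * c = 1 ∧ 𝒟 j = {z | circleFn a b e c z < 0} := by
    intro j
    by_cases hj : IsOpenDisk (𝒟 j)
    · obtain ⟨a, b, e, c, ha, hn, hD⟩ := IsOpenDisk.exists_circleFn hj
      exact ⟨a, b, e, c, ha.le, fun _ => ha, hn, hD⟩
    · have : IsOpenHalfPlane (𝒟 j) := by
        rcases h with h | ⟨k, hk, h⟩
        · exact absurd (h j) hj
        · by_cases hjk : j = k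
          · rwa [hjk]
          · exact absurd (h j hjk) hj
      obtain ⟨b, e, c, hn, hD⟩ := IsOpenHalfPlane.exists_circleFn this
      exact ⟨0, b, e, c, le_rfl, fun h => absurd h hj, by linarith, hD⟩
  choose a b e c ha hpos hn hD using hex
  have hg : ∀ j k, j ≠ k → b j * b k + e j * e k - (a j * c k + a k * c j) / 2 = -1 := by
    intro j k hjk
    obtain ⟨p, hp⟩ := htan j k hjk
    rw [hD j, hD k, closure_circleFn_neg (hn j), closure_circleFn_neg (hn k)] at hp
    exact gram_of_inter_eq_singleton (ha j) (ha k) (hn j) (hn k) hp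
  have hsum : 0 < a 0 * a 1 + a 1 * a 2 + a 2 * a 0 := by
    have n0 := ha 0
    have n1 := ha 1
    have n2 := ha 2
    rcases h with h | ⟨k, -, h⟩
    · have p0 := hpos 0 (h 0)
      have p1 := hpos 1 (h 1)
      have p2 := hpos 2 (h 2)
      positivity
    · fin_cases k
      · have p1 := hpos 1 (h 1 (by decide))
        have p2 := hpos 2 (h 2 (by decide))
        positivity
      · have p0 := hpos 0 (h 0 (by decide))
        have p2 := hpos 2 (h 2 (by decide))
        positivity
      · have p0 := hpos 0 (h 0 (by decide))
        have p1 := hpos 1 (h 1 (by decide))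
        positivity
  obtain ⟨F, hF⟩ := exists_frame ha hn hg hsum
  refine ⟨F, fun j => ?_, fun j => ?_⟩
  · obtain ⟨h1, h2, h3, h4⟩ := hF j
    rw [hD j]
    simp only [Frame.coord, h1, h2, h3, h4]
  · rw [hD j, curv_circleFn_neg (ha j) (hn j), (hF j).1]

/-- There is a frame with prescribed curvatures. -/
theorem exists_frame_a_eq {g : Fin 4 → ℝ} (hg : IsCurv g) : ∃ F : Frame, F.a = g := by
  let A : Fin 4 → ℝ := ![0, 2, 2, -2]
  let B : Fin 4 → ℝ := ![0, -1, 1, 0]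
  let E : Fin 4 → ℝ := ![1, 1, 1, -2]
  let C : Fin 4 → ℝ := ![2, 1/2, 1/2, -3/2]
  have hdual : IsDualFrame A B E C := by
    constructor <;> simp only [ell, A, B, E, C, Matrix.cons_val] <;> norm_num
  have hp : 0 < ell g A := by
    have h0 := hg.zero
    have h1 := hg.one
    have h2 := hg.two
    have h3 := hg.three
    have : ell g A = g 0 + g 1 / 2 + g 2 / 2 + g 3 := by
      simp only [ell, A, Matrix.cons_val]; ring
    rw [this]; positivity
  set k := ell g A with hk
  let r : (Fin 4 → ℝ) → Fin 4 → ℝ := fun x => x + ((ell x g - ell x A) / k) • (g - A)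
  have hr : ∀ x y, ell (r x) (r y) = ell x y := by
    intro x y
    have e : ∀ x y u : Fin 4 → ℝ, ∀ s t : ℝ, ell (x + s • u) (y + t • u) =
        ell x y + t * ell x u + s * ell y u + s * t * ell u u := by
      intro x y u s t
      simp only [ell, Pi.add_apply, Pi.smul_apply, smul_eq_mul]
      ring
    have eu : ∀ x, ell x (g - A) = ell x g - ell x A := by
      intro x; simp only [ell, Pi.sub_apply]; ring
    have euu : ell (g - A) (g - A) = -2 * k := by
      have h1 := hg.null
      have h2 := hdual.aa
      have : ell (g - A) (g - A) = ell g g + ell A A - 2 * ell g A := by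
        simp only [ell, Pi.sub_apply]; ring
      rw [this, h1, h2, ← hk]; ring
    simp only [r]
    rw [e, eu, eu, euu]
    field_simp
    ring
  have hrA : r A = g := by
    have : ell A g - ell A A = k := by rw [hdual.aa, ell_comm, ← hk]; ring
    simp only [r, this]
    rw [div_self hp.ne']
    simp
  have hd : IsDualFrame g (r B) (r E) (r C) := by
    rw [← hrA]
    obtain ⟨aa, ab, ae, ac, bb, be, bc, ee, ec, cc⟩ := hdual
    constructor <;> rw [hr] <;> assumption
  exact ⟨⟨g, r B, r E, r C, hd, hg.zero, hg.one, hg.two, hg.three⟩, rfl⟩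

namespace Frame

/-- The reflection of a frame. -/
def conj (F : Frame) : Frame where
  a := F.a
  b := -F.b
  e := F.e
  c := F.c
  dual := by
    obtain ⟨aa, ab, ae, ac, bb, be, bc, ee, ec, cc⟩ := F.dual
    constructor <;> simp only [ell, Pi.neg_apply] at * <;> linarith
  a0 := F.a0
  a1 := F.a1
  a2 := F.a2
  a3 := F.a3

variable (F : Frame)

/-- The disk triple of a frame. -/
def triple (j : Fin 3) : Set ℂ := {z | F.coord z j.castSucc < 0}

theorem describes_triple : F.Describes F.triple := fun _ => rfl

theorem triple_inter {j k : Fin 3} (hjk : j ≠ k) :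
    closure (F.triple j) ∩ closure (F.triple k) =
      {⟨(F.b j.castSucc + F.b k.castSucc) / (F.a j.castSucc + F.a k.castSucc),
        (F.e j.castSucc + F.e k.castSucc) / (F.a j.castSucc + F.a k.castSucc)⟩} := by
  rw [F.describes_triple.closure_eq, F.describes_triple.closure_eq]
  exact inter_eq_singleton_of_gram (F.a_add_pos hjk) (F.norm_eq _) (F.norm_eq _) (F.gram_ne hjk)

theorem triple_isOpenDisk {j : Fin 3} (h : 0 < F.a j.castSucc) : IsOpenDisk (F.triple j) :=
  ⟨_, _, inv_pos.2 h, circleFn_neg_eq_ball h (F.norm_eq _)⟩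

theorem isTDT_triple : IsTDT F.triple := by
  refine ⟨?_, fun j k hjk => ⟨_, F.triple_inter hjk⟩⟩
  by_cases h : ∀ j : Fin 3, 0 < F.a j.castSucc
  · exact Or.inl fun j => F.triple_isOpenDisk (h j)
  · push Not at h
    obtain ⟨j, hj⟩ := h
    have hj : F.a j.castSucc = 0 := le_antisymm hj (F.a_nonneg j)
    refine Or.inr ⟨j, ?_, fun k hk => F.triple_isOpenDisk ?_⟩
    · have := F.norm_eq j.castSucc
      rw [hj] at this
      have h2 : F.triple j =
          {z | circleFn 0 (F.b j.castSucc) (F.e j.castSucc) (F.c j.castSucc) z < 0} := by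
        simp only [triple, coord, hj]
      rw [h2]
      exact isOpenHalfPlane_circleFn (by linarith)
    · have := F.a_add_pos hk
      linarith

theorem curv_triple (j : Fin 3) : curv (F.triple j) = F.a j.castSucc :=
  curv_circleFn_neg (F.a_nonneg j) (F.norm_eq _)

theorem tangencyPoint_triple (j : Fin 3) : tangencyPoint F.triple j =
    ⟨(F.b (j + 1).castSucc + F.b (j + 2).castSucc) / (F.a (j + 1).castSucc + F.a (j + 2).castSucc),
      (F.e (j + 1).castSucc + F.e (j + 2).castSucc) /
        (F.a (j + 1).castSucc + F.a (j + 2).castSucc)⟩ := by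
  have hne : j + 1 ≠ j + 2 := by fin_cases j <;> decide
  have h := F.triple_inter hne
  have h2 := Classical.epsilon_spec (p := fun p : ℂ =>
    closure (F.triple (j + 1)) ∩ closure (F.triple (j + 2)) = {p}) ⟨_, h⟩
  exact (Set.singleton_eq_singleton_iff.1 (h.symm.trans h2)).symm

/-- The determinant whose sign is the orientation of the triple. -/
def orient : ℝ := F.a 0 * (F.b 1 * F.e 2 - F.b 2 * F.e 1) -
  F.a 1 * (F.b 0 * F.e 2 - F.b 2 * F.e 0) + F.a 2 * (F.b 0 * F.e 1 - F.b 1 * F.e 0)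

theorem orient_conj : F.conj.orient = -F.orient := by
  simp only [orient, conj, Pi.neg_apply]; ring

theorem orient_ne_zero : F.orient ≠ 0 := by
  have hG : ∀ G : Fin 4 → Fin 4 → ℝ, (∀ j k, F.b j * F.b k + F.e j * F.e k -
      (F.a j * F.c k + F.a k * F.c j) / 2 = G j k) → F.orient ^ 2 =
      F.a 0 ^ 2 * (G 1 1 * G 2 2 - G 1 2 ^ 2) + F.a 1 ^ 2 * (G 0 0 * G 2 2 - G 0 2 ^ 2) +
        F.a 2 ^ 2 * (G 0 0 * G 1 1 - G 0 1 ^ 2) +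
        2 * F.a 0 * F.a 1 * (G 0 2 * G 1 2 - G 0 1 * G 2 2) +
        2 * F.a 0 * F.a 2 * (G 0 1 * G 1 2 - G 0 2 * G 1 1) +
        2 * F.a 1 * F.a 2 * (G 0 1 * G 0 2 - G 1 2 * G 0 0) := by
    intro G hG
    simp only [← hG, orient]
    ring
  have h := hG _ F.gram
  obtain ⟨v00, v11, v22, v33, v01, v02, v12, v03, v13, v23⟩ := gramMat_values
  rw [v00, v11, v22, v01, v02, v12] at h
  have h2 : F.orient ^ 2 = 4 * F.a 3 ^ 2 := by rw [h, F.a_sq]; ring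
  have := F.a3
  intro h0
  rw [h0] at h2
  have : 0 < F.a 3 ^ 2 := by positivity
  linarith

theorem isTDTplus_triple (h : 0 < F.orient) : IsTDTplus F.triple := by
  refine ⟨F.isTDT_triple, ?_⟩
  obtain ⟨p0, p1, p2⟩ := F.pair_pos
  rw [F.tangencyPoint_triple 0, F.tangencyPoint_triple 1, F.tangencyPoint_triple 2]
  have e1 : ((0 : Fin 3) + 1).castSucc = (1 : Fin 4) := rfl
  have e2 : ((0 : Fin 3) + 2).castSucc = (2 : Fin 4) := rfl
  have e3 : ((1 : Fin 3) + 1).castSucc = (2 : Fin 4) := rfl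
  have e4 : ((1 : Fin 3) + 2).castSucc = (0 : Fin 4) := rfl
  have e5 : ((2 : Fin 3) + 1).castSucc = (0 : Fin 4) := rfl
  have e6 : ((2 : Fin 3) + 2).castSucc = (1 : Fin 4) := rfl
  rw [e1, e2, e3, e4, e5, e6]
  have hq : 0 < 2 * F.orient / ((F.a 1 + F.a 2) * (F.a 0 + F.a 2) * (F.a 0 + F.a 1)) := by
    positivity
  convert hq using 1
  simp only [Complex.sub_re, Complex.sub_im, orient]
  have p1' : F.a 2 + F.a 0 ≠ 0 := by linarith
  field_simp
  ring

end Frame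

/-- The chosen triple is described by a frame with the prescribed curvatures. -/
theorem exists_frame_tripleOf {g : Fin 4 → ℝ} (hg : IsCurv g) :
    ∃ F : Frame, F.Describes (tripleOf g) ∧ F.a = g := by
  have hex : ∃ 𝒟 : Fin 3 → Set ℂ,
      IsTDTplus 𝒟 ∧ curv (𝒟 0) = g 0 ∧ curv (𝒟 1) = g 1 ∧ curv (𝒟 2) = g 2 := by
    obtain ⟨F, rfl⟩ := exists_frame_a_eq hg
    rcases lt_or_gt_of_ne F.orient_ne_zero with h | h
    · refine ⟨F.conj.triple, F.conj.isTDTplus_triple ?_, F.conj.curv_triple 0,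
        F.conj.curv_triple 1, F.conj.curv_triple 2⟩
      rw [F.orient_conj]; linarith
    · exact ⟨F.triple, F.isTDTplus_triple h, F.curv_triple 0, F.curv_triple 1, F.curv_triple 2⟩
  obtain ⟨hT, h0, h1, h2⟩ := Classical.epsilon_spec hex
  obtain ⟨F, hF, ha⟩ := exists_frame_of_isTDT hT.1
  exact ⟨F, hF, F.a_three_eq_of_null hg ((ha 0).trans h0) ((ha 1).trans h1) ((ha 2).trans h2)⟩

/-- The cone of coordinate vectors of points of the closed triangle. -/
structure IsCone (x : Fin 4 → ℝ) : Prop where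
  zero : 0 ≤ x 0
  one : 0 ≤ x 1
  two : 0 ≤ x 2
  three : x 3 ≤ 0
  null : ell x x = 0

theorem IsCone.neg_three_le {x : Fin 4 → ℝ} (hx : IsCone x) : -x 3 ≤ x 0 + x 1 + x 2 := by
  obtain ⟨h0, h1, h2, h3, hn⟩ := hx
  simp only [ell] at hn
  have := mul_nonneg h0 h1
  have := mul_nonneg h1 h2
  have := mul_nonneg h2 h0
  apply le_of_sq_le_sq ?_ (by positivity)
  nlinarith [sq_nonneg (x 0), sq_nonneg (x 1), sq_nonneg (x 2)]

theorem IsCone.sum_pos {x g : Fin 4 → ℝ} (hx : IsCone x) (h : ell x g ≠ 0) :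
    0 < x 0 + x 1 + x 2 := by
  have h4 := hx.neg_three_le
  obtain ⟨h0, h1, h2, h3, hn⟩ := hx
  rcases (show 0 ≤ x 0 + x 1 + x 2 by positivity).lt_or_eq with hs | hs
  · exact hs
  · have e0 : x 0 = 0 := by linarith
    have e1 : x 1 = 0 := by linarith
    have e2 : x 2 = 0 := by linarith
    have e3 : x 3 = 0 := by linarith
    exact absurd (by simp [ell, e0, e1, e2, e3]) h

theorem IsCurv.pair_pos {g : Fin 4 → ℝ} (hg : IsCurv g) :
    0 < g 1 + g 2 ∧ 0 < g 0 + g 2 ∧ 0 < g 0 + g 1 := by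
  obtain ⟨F, rfl⟩ := exists_frame_a_eq hg
  exact F.pair_pos

theorem IsCurv.ell_pos {g x : Fin 4 → ℝ} (hg : IsCurv g) (hx : IsCone x)
    (hs : 0 < x 0 + x 1 + x 2) : 0 < ell x g :=
  Apollonian.ell_pos hx.zero hx.one hx.two hx.three hs hg.pair_pos.1 hg.pair_pos.2.1
    hg.pair_pos.2.2 hg.three.le

theorem IsCone.le_ell {g x : Fin 4 → ℝ} (hx : IsCone x) (h3 : 0 ≤ g 3) {c : ℝ}
    (h12 : c ≤ g 1 + g 2) (h02 : c ≤ g 0 + g 2) (h01 : c ≤ g 0 + g 1) :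
    c / 4 * (x 0 + x 1 + x 2) ≤ ell x g := by
  have e0 := mul_le_mul_of_nonneg_left h12 hx.zero
  have e1 := mul_le_mul_of_nonneg_left h02 hx.one
  have e2 := mul_le_mul_of_nonneg_left h01 hx.two
  have e3 := mul_nonneg (neg_nonneg.2 hx.three) h3
  unfold ell
  linarith

theorem IsCone.abs_ell_le {v x : Fin 4 → ℝ} (hx : IsCone x) {m n : ℝ}
    (h0 : |v 0| ≤ m) (h1 : |v 1| ≤ m) (h2 : |v 2| ≤ m) (h3 : |v 3| ≤ n) :
    |ell x v| ≤ (m / 2 + n / 2) * (x 0 + x 1 + x 2) := by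
  have h4 := hx.neg_three_le
  obtain ⟨x0, x1, x2, x3, -⟩ := hx
  rw [abs_le] at h0 h1 h2 h3
  have hn : 0 ≤ n := by linarith
  have a0 := mul_le_mul_of_nonneg_left (show v 1 + v 2 ≤ 2 * m by linarith) x0
  have a1 := mul_le_mul_of_nonneg_left (show v 0 + v 2 ≤ 2 * m by linarith) x1
  have a2 := mul_le_mul_of_nonneg_left (show v 0 + v 1 ≤ 2 * m by linarith) x2
  have b0 := mul_le_mul_of_nonneg_left (show -(2 * m) ≤ v 1 + v 2 by linarith) x0
  have b1 := mul_le_mul_of_nonneg_left (show -(2 * m) ≤ v 0 + v 2 by linarith) x1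
  have b2 := mul_le_mul_of_nonneg_left (show -(2 * m) ≤ v 0 + v 1 by linarith) x2
  have a3 := mul_le_mul_of_nonneg_left h3.2 (neg_nonneg.2 x3)
  have b3 := mul_le_mul_of_nonneg_left h3.1 (neg_nonneg.2 x3)
  have c3 := mul_le_mul_of_nonneg_left h4 hn
  rw [abs_le]
  unfold ell
  constructor <;> linarith

theorem ell_smul_left (t : ℝ) (x g : Fin 4 → ℝ) : ell (t • x) g = t * ell x g := by
  simp only [ell, Pi.smul_apply, smul_eq_mul]; ring

theorem ell_smul_right (t : ℝ) (x g : Fin 4 → ℝ) : ell x (t • g) = t * ell x g := by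
  simp only [ell, Pi.smul_apply, smul_eq_mul]; ring

theorem inscr_smul (t : ℝ) (x : Fin 4 → ℝ) : inscr (t • x) = t * inscr x := by
  simp only [inscr, Pi.smul_apply, smul_eq_mul]; ring

/-- Any two curvature vectors are comparable on the cone. -/
theorem IsCurv.exists_ell_le {g h : Fin 4 → ℝ} (hg : IsCurv g) (hh : IsCurv h) :
    ∃ K : ℝ, 0 < K ∧ ∀ x, IsCone x → ell x g ≤ K * ell x h := by
  obtain ⟨p0, p1, p2⟩ := hh.pair_pos
  set c := min (h 1 + h 2) (min (h 0 + h 2) (h 0 + h 1)) with hc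
  have hcpos : 0 < c := lt_min p0 (lt_min p1 p2)
  set m := g 0 + g 1 + g 2 + g 3 with hm
  have g0 := hg.zero
  have g1 := hg.one
  have g2 := hg.two
  have g3 := hg.three
  refine ⟨m / (c / 4), by positivity, fun x hx => ?_⟩
  have h1 := hx.le_ell hh.three.le (c := c) (min_le_left _ _)
    ((min_le_right _ _).trans (min_le_left _ _)) ((min_le_right _ _).trans (min_le_right _ _))
  have h2 := (le_abs_self _).trans (hx.abs_ell_le (v := g) (m := m) (n := m)
    (by rw [abs_of_nonneg g0]; linarith) (by rw [abs_of_nonneg g1]; linarith)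
    (by rw [abs_of_nonneg g2]; linarith) (by rw [abs_of_pos g3]; linarith))
  calc ell x g ≤ m * (x 0 + x 1 + x 2) := by linarith
    _ = m / (c / 4) * (c / 4 * (x 0 + x 1 + x 2)) := by field_simp
    _ ≤ m / (c / 4) * ell x h := by gcongr

namespace Frame

theorem isCone_coord (F : Frame) {z : ℂ} (hz : z ∈ closure F.tri) : IsCone (F.coord z) := by
  have key : ∀ S : Set ℂ, IsClosed S → F.tri ⊆ S → z ∈ S := fun S hS hsub =>
    closure_minimal hsub hS hz
  refine ⟨?_, ?_, ?_, ?_, F.ell_coord_self z⟩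
  · exact key {z | 0 ≤ F.coord z 0} (isClosed_le continuous_const (F.continuous_coord 0))
      fun w hw => hw.1.le
  · exact key {z | 0 ≤ F.coord z 1} (isClosed_le continuous_const (F.continuous_coord 1))
      fun w hw => hw.2.1.le
  · exact key {z | 0 ≤ F.coord z 2} (isClosed_le continuous_const (F.continuous_coord 2))
      fun w hw => hw.2.2.1.le
  · exact key {z | F.coord z 3 ≤ 0} (isClosed_le (F.continuous_coord 3) continuous_const)
      fun w hw => hw.2.2.2.le

theorem coord_sum_pos (F : Frame) {z : ℂ} (hz : z ∈ closure F.tri) :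
    0 < F.coord z 0 + F.coord z 1 + F.coord z 2 :=
  (F.isCone_coord hz).sum_pos (g := F.a) (by rw [F.ell_coord_a]; exact one_ne_zero)

theorem ell_coord_pos (F F' : Frame) {z : ℂ} (hz : z ∈ closure F.tri) :
    0 < ell (F.coord z) F'.a :=
  F'.isCurv.ell_pos (F.isCone_coord hz) (F.coord_sum_pos hz)

theorem point_smul (F : Frame) {t : ℝ} (ht : t ≠ 0) (x : Fin 4 → ℝ) :
    F.point (t • x) = F.point x := by
  simp only [point, ell_smul_left, mul_div_mul_left _ _ ht]

/-- The residual set of a frame. -/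
def gasket (F : Frame) : Set ℂ :=
  {z | z ∈ closure F.tri ∧ ∀ w, 0 ≤ inscr (F.coord z ᵥ* Mword w)}

/-- The transition map between the triangles of two frames. -/
noncomputable def trans (F F' : Frame) (z : ℂ) : ℂ := F'.point (F.coord z)

variable (F F' : Frame)

theorem coord_trans {z : ℂ} (hz : z ∈ closure F.tri) :
    F'.coord (F.trans F' z) = (ell (F.coord z) F'.a)⁻¹ • F.coord z := by
  funext i
  rw [trans, F'.coord_point (F.ell_coord_self z) (F.ell_coord_pos F' hz).ne', Pi.smul_apply,
    smul_eq_mul, div_eq_inv_mul]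

theorem trans_trans {z : ℂ} (hz : z ∈ closure F.tri) : F'.trans F (F.trans F' z) = z := by
  rw [trans, F.coord_trans F' hz, F.point_smul (inv_ne_zero (F.ell_coord_pos F' hz).ne'),
    F.point_coord]

theorem mapsTo_trans_tri : Set.MapsTo (F.trans F') F.tri F'.tri := by
  intro z hz
  have h := F.coord_trans F' (subset_closure hz)
  have hp := inv_pos.2 (F.ell_coord_pos F' (subset_closure hz))
  obtain ⟨h0, h1, h2, h3⟩ := hz
  refine ⟨?_, ?_, ?_, ?_⟩ <;> rw [h, Pi.smul_apply, smul_eq_mul]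
  · exact mul_pos hp h0
  · exact mul_pos hp h1
  · exact mul_pos hp h2
  · exact mul_neg_of_pos_of_neg hp h3

theorem continuousAt_trans {z : ℂ} (hz : z ∈ closure F.tri) : ContinuousAt (F.trans F') z := by
  have hcont : ∀ g : Fin 4 → ℝ, Continuous fun z : ℂ => ell (F.coord z) g := by
    intro g
    simp only [ell]
    have h0 := F.continuous_coord 0
    have h1 := F.continuous_coord 1
    have h2 := F.continuous_coord 2
    have h3 := F.continuous_coord 3
    fun_prop
  have hcl : Continuous fun p : ℝ × ℝ => (⟨p.1, p.2⟩ : ℂ) :=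
    Complex.equivRealProdCLM.symm.continuous
  have hne := (F.ell_coord_pos F' hz).ne'
  exact hcl.continuousAt.comp (f := fun z => (ell (F.coord z) F'.b / ell (F.coord z) F'.a,
    ell (F.coord z) F'.e / ell (F.coord z) F'.a))
    (((hcont _).continuousAt.div (hcont _).continuousAt hne).prodMk
      ((hcont _).continuousAt.div (hcont _).continuousAt hne))

theorem trans_mem_closure {z : ℂ} (hz : z ∈ closure F.tri) :
    F.trans F' z ∈ closure F'.tri :=
  (F.continuousAt_trans F' hz).continuousWithinAt.mem_closure hz (F.mapsTo_trans_tri F')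

theorem mapsTo_trans_gasket : Set.MapsTo (F.trans F') F.gasket F'.gasket := by
  rintro z ⟨hz, hw⟩
  refine ⟨F.trans_mem_closure F' hz, fun w => ?_⟩
  rw [F.coord_trans F' hz, Matrix.smul_vecMul, inscr_smul]
  exact mul_nonneg (inv_nonneg.2 (F.ell_coord_pos F' hz).le) (hw w)

theorem image_gasket : F.trans F' '' F.gasket = F'.gasket := by
  apply Set.Subset.antisymm (F.mapsTo_trans_gasket F').image_subset
  intro z hz
  exact ⟨F'.trans F z, F'.mapsTo_trans_gasket F hz, F'.trans_trans F hz.1⟩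

theorem dist_trans_sq {z w : ℂ} (hz : z ∈ closure F.tri) (hw : w ∈ closure F.tri) :
    dist (F.trans F' z) (F.trans F' w) ^ 2 =
      (ell (F.coord z) F'.a)⁻¹ * (ell (F.coord w) F'.a)⁻¹ * dist z w ^ 2 := by
  rw [← F'.ell_coord_coord, ← F.ell_coord_coord, F.coord_trans F' hz, F.coord_trans F' hw,
    ell_smul_left, ell_smul_right]
  ring

theorem lipschitzOnWith_trans {K : ℝ≥0} (hK : ∀ x, IsCone x → ell x F.a ≤ K * ell x F'.a) :
    LipschitzOnWith K (F.trans F') F.gasket := by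
  refine LipschitzOnWith.of_dist_le_mul fun z hz w hw => ?_
  have key : ∀ z ∈ closure F.tri, (ell (F.coord z) F'.a)⁻¹ ≤ K := by
    intro z hz
    have h1 := hK _ (F.isCone_coord hz)
    rw [F.ell_coord_a] at h1
    exact (inv_le_iff_one_le_mul₀ (F.ell_coord_pos F' hz)).2 h1
  refine le_of_sq_le_sq ?_ (by positivity)
  rw [F.dist_trans_sq F' hz.1 hw.1, mul_pow, sq (K : ℝ)]
  have h1 := key z hz.1
  have h2 := key w hw.1
  have h3 := inv_nonneg.2 (F.ell_coord_pos F' hw.1).le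
  gcongr

theorem hausdorffMeasure_gasket_le {K : ℝ≥0}
    (hK : ∀ x, IsCone x → ell x F.a ≤ K * ell x F'.a) {d : ℝ} (hd : 0 ≤ d) :
    μH[d] F'.gasket ≤ (K : ℝ≥0∞) ^ d * μH[d] F.gasket := by
  rw [← F.image_gasket F']
  exact (F.lipschitzOnWith_trans F' hK).hausdorffMeasure_image_le hd

end Frame

theorem dAG_nonneg : 0 ≤ dAG := ENNReal.toReal_nonneg

/-- Comparison of the gasket measures of comparable curvature vectors. -/
theorem HGamma_le {g h : Fin 4 → ℝ} (hg : IsCurv g) (hh : IsCurv h) {K : ℝ} (hK0 : 0 ≤ K)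
    (hK : ∀ x, IsCone x → ell x g ≤ K * ell x h) : HGamma h ≤ K ^ dAG * HGamma g := by
  obtain ⟨F, hF, hFg⟩ := exists_frame_tripleOf hg
  obtain ⟨F', hF', hFh⟩ := exists_frame_tripleOf hh
  have e : AG (tripleOf g) = F.gasket := hF.AG_eq
  have e' : AG (tripleOf h) = F'.gasket := hF'.AG_eq
  rw [HGamma, HGamma, e, e']
  subst hFg hFh
  lift K to ℝ≥0 using hK0
  have hle := F.hausdorffMeasure_gasket_le F' (K := K) hK dAG_nonneg
  have hKd : (K : ℝ≥0∞) ^ dAG ≠ ∞ :=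
    ENNReal.rpow_ne_top_of_nonneg dAG_nonneg ENNReal.coe_ne_top
  by_cases htop : μH[dAG] F.gasket = ∞
  · obtain ⟨K', hK'0, hK'⟩ := hh.exists_ell_le hg
    lift K' to ℝ≥0 using hK'0.le
    have hle' := F'.hausdorffMeasure_gasket_le F (K := K') hK' dAG_nonneg
    have htop' : μH[dAG] F'.gasket = ∞ := by
      by_contra hne
      rw [htop] at hle'
      exact (ENNReal.mul_lt_top (ENNReal.rpow_lt_top_of_nonneg dAG_nonneg ENNReal.coe_ne_top)
        (lt_top_iff_ne_top.2 hne)).not_ge hle'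
    rw [htop, htop']
    simp
  · have h2 := ENNReal.toReal_mono (ENNReal.mul_ne_top hKd htop) hle
    rw [ENNReal.toReal_mul, ← ENNReal.toReal_rpow] at h2
    exact h2

/-- The frame of the base triple. -/
noncomputable def baseFrame : Frame where
  a := ![0, 2, 2, 2]
  b := ![0, -1, 1, 0]
  e := ![1, 1, 1, 2]
  c := ![2, 1/2, 1/2, 3/2]
  dual := by constructor <;> simp only [ell, Matrix.cons_val] <;> norm_num
  a0 := by simp
  a1 := by simp
  a2 := by simp
  a3 := by simp

theorem baseFrame_coord (z : ℂ) : baseFrame.coord z =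
    ![2 * (1 - z.im), 2 * (z.re ^ 2 + z.im ^ 2) + 2 * z.re - 2 * z.im + 1 / 2,
      2 * (z.re ^ 2 + z.im ^ 2) - 2 * z.re - 2 * z.im + 1 / 2,
      2 * (z.re ^ 2 + z.im ^ 2) - 4 * z.im + 3 / 2] := by
  funext i
  fin_cases i <;> simp [Frame.coord, circleFn, baseFrame] <;>
    first | ring1 | (left; norm_num)

theorem baseFrame_describes : baseFrame.Describes baseTriple := by
  intro j
  fin_cases j
  · ext z
    have e : ((1 < z.im) : Prop) ↔ 2 * (1 - z.im) < 0 := by constructor <;> intro h <;> linarith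
    simp only [baseFrame_coord, baseTriple]
    exact e
  · have h := circleFn_neg_eq_ball (show 0 < baseFrame.a 1 by simp [baseFrame])
      (baseFrame.norm_eq 1)
    refine Eq.trans ?_ h.symm
    have hr : (baseFrame.a 1)⁻¹ = 1 / 2 := by simp [baseFrame]
    have hc : (⟨baseFrame.b 1 / baseFrame.a 1, baseFrame.e 1 / baseFrame.a 1⟩ : ℂ) =
        Complex.I / 2 - 1 / 2 := by
      apply Complex.ext <;> simp [baseFrame]
      norm_num
    rw [hr, hc]
    rfl
  · have h := circleFn_neg_eq_ball (show 0 < baseFrame.a 2 by simp [baseFrame])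
      (baseFrame.norm_eq 2)
    refine Eq.trans ?_ h.symm
    have hr : (baseFrame.a 2)⁻¹ = 1 / 2 := by simp [baseFrame]
    have hc : (⟨baseFrame.b 2 / baseFrame.a 2, baseFrame.e 2 / baseFrame.a 2⟩ : ℂ) =
        Complex.I / 2 + 1 / 2 := by
      apply Complex.ext <;> simp [baseFrame]
    rw [hr, hc]
    rfl

theorem Frame.tri_step_subset (F : Frame) (j : Fin 3) : (F.step j).tri ⊆ F.tri := by
  rintro z hz
  simp only [Frame.tri, Set.mem_ofPred_eq, Frame.step_coord] at hz ⊢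
  revert hz
  refine Mmat_induction (P := fun x y => (0 < y 0 ∧ 0 < y 1 ∧ 0 < y 2 ∧ y 3 < 0) →
    0 < x 0 ∧ 0 < x 1 ∧ 0 < x 2 ∧ x 3 < 0) j (F.coord z) ?_ ?_ ?_ <;>
  · simp only [inscr, Matrix.cons_val]
    rintro ⟨h0, h1, h2, h3⟩
    refine ⟨?_, ?_, ?_, ?_⟩ <;> linarith

theorem Frame.tri_word_subset (F : Frame) (w : Word) : (F.word w).tri ⊆ F.tri := by
  induction w generalizing F with
  | nil => exact subset_rfl
  | cons j w ih => exact (ih (F.step j)).trans (F.tri_step_subset j)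

theorem segment_subset_gasket :
    (fun x : ℝ => (x : ℂ) + Complex.I) '' Set.Ioo (-1 / 2) (1 / 2) ⊆ baseFrame.gasket := by
  rintro _ ⟨x, ⟨hx1, hx2⟩, rfl⟩
  set z : ℂ := (x : ℂ) + Complex.I with hz
  have hre : z.re = x := by simp [hz]
  have him : z.im = 1 := by simp [hz]
  have h0 : baseFrame.coord z 0 = 0 := by
    rw [baseFrame_coord]; simp [him]
  refine ⟨?_, fun w => ?_⟩
  · have hopen : IsOpen {z | 0 < baseFrame.coord z 1 ∧ 0 < baseFrame.coord z 2 ∧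
        baseFrame.coord z 3 < 0} :=
      (isOpen_lt continuous_const (baseFrame.continuous_coord 1)).inter
        ((isOpen_lt continuous_const (baseFrame.continuous_coord 2)).inter
          (isOpen_lt (baseFrame.continuous_coord 3) continuous_const))
    have hmem : z ∈ {z | 0 < baseFrame.coord z 1 ∧ 0 < baseFrame.coord z 2 ∧
        baseFrame.coord z 3 < 0} := by
      simp only [Set.mem_ofPred_eq, baseFrame_coord, Matrix.cons_val, hre, him]
      refine ⟨?_, ?_, ?_⟩ <;> nlinarith
    have hcl : z ∈ closure {z | circleFn 0 0 (-1) (-2) z < 0} := by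
      rw [closure_circleFn_neg (by norm_num)]
      simp [circleFn, him]
    refine closure_mono ?_ (hopen.inter_closure ⟨hmem, hcl⟩)
    rintro w ⟨⟨h1, h2, h3⟩, h0⟩
    refine ⟨?_, h1, h2, h3⟩
    have h0 : circleFn 0 0 (-1) (-2) w < 0 := h0
    rw [baseFrame_coord]
    simp only [circleFn, Matrix.cons_val] at h0 ⊢
    linarith
  · by_contra hneg
    rw [← Frame.word_coord] at hneg
    have h1 := baseFrame.tri_word_subset w
      ((baseFrame.word w).inDisk_subset_tri (not_le.1 hneg))
    exact h1.1.ne' h0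

theorem one_le_dAG : 1 ≤ dAG := by
  have hAG : AG baseTriple = baseFrame.gasket := baseFrame_describes.AG_eq
  have hiso : Isometry fun x : ℝ => (x : ℂ) + Complex.I :=
    Isometry.of_dist_eq fun x y => by simp [Complex.dist_eq, Real.dist_eq, ← Complex.ofReal_sub]
  have h1 : (1 : ℝ≥0∞) ≤ dimH (AG baseTriple) := by
    rw [hAG]
    refine le_trans ?_ (dimH_mono segment_subset_gasket)
    rw [hiso.dimH_image, Real.dimH_of_nonempty_interior]
    · simp
    · rw [interior_Ioo, Set.nonempty_Ioo]; norm_num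
  rw [dAG, ← ENNReal.toReal_one]
  exact ENNReal.toReal_mono (Real.dimH_ne_top _) h1

theorem HGamma_rpow_le {g h : Fin 4 → ℝ} (hg : IsCurv g) (hh : IsCurv h) {K : ℝ} (hK0 : 0 ≤ K)
    (hK : ∀ x, IsCone x → ell x g ≤ K * ell x h) :
    HGamma h ^ (1 / dAG) ≤ K * HGamma g ^ (1 / dAG) := by
  have hd : 0 < dAG := lt_of_lt_of_le one_pos one_le_dAG
  have hnn : ∀ g, 0 ≤ HGamma g := fun _ => ENNReal.toReal_nonneg
  calc HGamma h ^ (1 / dAG) ≤ (K ^ dAG * HGamma g) ^ (1 / dAG) :=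
        Real.rpow_le_rpow (hnn h) (HGamma_le hg hh hK0 hK) (by positivity)
    _ = K * HGamma g ^ (1 / dAG) := by
        rw [Real.mul_rpow (Real.rpow_nonneg hK0 _) (hnn g), one_div,
          Real.rpow_rpow_inv hK0 hd.ne']

theorem IsCone.exists_vecMul_Mmat {x : Fin 4 → ℝ} (hx : IsCone x) (j : Fin 3) :
    ∃ y, IsCone y ∧ y ᵥ* Mmat j = x := by
  have hnull : ∀ y, y ᵥ* Mmat j = x → ell y y = 0 := fun y hy => by
    rw [← ell_vecMul_Mmat j, hy, hx.null]
  obtain ⟨h0, h1, h2, h3, -⟩ := hx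
  fin_cases j
  · have hy : ![x 0 + x 1 + x 2 - 2 * x 3, x 1, x 2, x 3 - x 1 - x 2] ᵥ* Mmat 0 = x := by
      rw [vecMul_Mmat_zero]
      funext i
      fin_cases i <;> simp [inscr]
      ring
    refine ⟨_, ⟨?_, ?_, ?_, ?_, hnull _ hy⟩, hy⟩ <;> simp only [Matrix.cons_val] <;> linarith
  · have hy : ![x 0, x 0 + x 1 + x 2 - 2 * x 3, x 2, x 3 - x 0 - x 2] ᵥ* Mmat 1 = x := by
      rw [vecMul_Mmat_one]
      funext i
      fin_cases i <;> simp [inscr]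
      ring
    refine ⟨_, ⟨?_, ?_, ?_, ?_, hnull _ hy⟩, hy⟩ <;> simp only [Matrix.cons_val] <;> linarith
  · have hy : ![x 0, x 1, x 0 + x 1 + x 2 - 2 * x 3, x 3 - x 0 - x 1] ᵥ* Mmat 2 = x := by
      rw [vecMul_Mmat_two]
      funext i
      fin_cases i <;> simp [inscr]
      ring
    refine ⟨_, ⟨?_, ?_, ?_, ?_, hnull _ hy⟩, hy⟩ <;> simp only [Matrix.cons_val] <;> linarith

theorem IsCone.exists_vecMul_Mword {x : Fin 4 → ℝ} (hx : IsCone x) (w : Word) :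
    ∃ y, IsCone y ∧ y ᵥ* Mword w = x := by
  induction w with
  | nil => exact ⟨x, hx, vecMul_Mword_nil x⟩
  | cons j w ih =>
    obtain ⟨y, hy, rfl⟩ := ih
    obtain ⟨y', hy', rfl⟩ := hy.exists_vecMul_Mmat j
    exact ⟨y', hy', vecMul_Mword_cons _ _ _⟩

/-- Relative closeness on the cone. -/
def RelClose (η : ℝ) (g h : Fin 4 → ℝ) : Prop :=
  ∀ x, IsCone x → |ell x g - ell x h| ≤ η * ell x g ∧ |ell x g - ell x h| ≤ η * ell x h

theorem RelClose.symm {η : ℝ} {g h : Fin 4 → ℝ} (H : RelClose η g h) : RelClose η h g :=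
  fun x hx => by
    rw [abs_sub_comm]
    exact ⟨(H x hx).2, (H x hx).1⟩

theorem RelClose.vecMul_Mword {η : ℝ} {g h : Fin 4 → ℝ} (H : RelClose η g h) (w : Word) :
    RelClose η (g ᵥ* Mword w) (h ᵥ* Mword w) := by
  intro x hx
  obtain ⟨y, hy, rfl⟩ := hx.exists_vecMul_Mword w
  simp only [ell_vecMul_Mword]
  exact H y hy

/-- The closeness of coordinates implied by relative closeness on the cone. -/
theorem RelClose.abs_sub_le {η : ℝ} {g h : Fin 4 → ℝ} (H : RelClose η g h) :
    |g 0 - h 0| ≤ η * (h 0 + h 1 + h 2) ∧ |g 1 - h 1| ≤ η * (h 0 + h 1 + h 2) ∧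
      |g 2 - h 2| ≤ η * (h 0 + h 1 + h 2) := by
  have h0 := (H ![1, 0, 0, 0] (by constructor <;> simp [ell])).2
  have h1 := (H ![0, 1, 0, 0] (by constructor <;> simp [ell])).2
  have h2 := (H ![0, 0, 1, 0] (by constructor <;> simp [ell])).2
  simp only [ell, Matrix.cons_val, abs_le] at h0 h1 h2 ⊢
  obtain ⟨a0, b0⟩ := h0
  obtain ⟨a1, b1⟩ := h1
  obtain ⟨a2, b2⟩ := h2
  refine ⟨⟨?_, ?_⟩, ⟨?_, ?_⟩, ⟨?_, ?_⟩⟩ <;> linarith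

theorem RelClose.HGamma_rpow_le {η : ℝ} (hη : 0 ≤ η) {g h : Fin 4 → ℝ} (H : RelClose η g h)
    (hg : IsCurv g) (hh : IsCurv h) :
    HGamma h ^ (1 / dAG) ≤ (1 + η) * HGamma g ^ (1 / dAG) :=
  Apollonian.HGamma_rpow_le hg hh (by positivity) fun x hx => by
    have := (le_abs_self _).trans (H x hx).2
    linarith

theorem RelClose.abs_normalized_sub_le {η : ℝ} (hη : 0 ≤ η) {g h : Fin 4 → ℝ}
    (H : RelClose η g h) (hg : IsCurv g) (hh : IsCurv h) {C : ℝ}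
    (hgC : HGamma g ^ (1 / dAG) * (g 0 + g 1 + g 2) ≤ C)
    (hhC : HGamma h ^ (1 / dAG) * (h 0 + h 1 + h 2) ≤ C) {i : Fin 4} (hi : i ≠ 3) :
    |HGamma g ^ (1 / dAG) * g i - HGamma h ^ (1 / dAG) * h i| ≤ 2 * η * C := by
  have l1 := H.HGamma_rpow_le hη hg hh
  have l2 := H.symm.HGamma_rpow_le hη hh hg
  have hp : ∀ g, 0 ≤ HGamma g ^ (1 / dAG) := fun g => Real.rpow_nonneg ENNReal.toReal_nonneg _
  have p1 := hp g
  have p2 := hp h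
  set P := HGamma g ^ (1 / dAG)
  set Q := HGamma h ^ (1 / dAG)
  obtain ⟨c0, c1, c2⟩ := H.abs_sub_le
  have g0 := hg.zero
  have g1 := hg.one
  have g2 := hg.two
  have key : ∀ u v : ℝ, 0 ≤ u → u ≤ g 0 + g 1 + g 2 → |u - v| ≤ η * (h 0 + h 1 + h 2) →
      |P * u - Q * v| ≤ 2 * η * C := by
    intro u v hu hus huv
    have hPQ : |P - Q| ≤ η * P := by
      rcases le_total P Q with hle | hle
      · rw [abs_of_nonpos (by linarith)]
        linarith
      · have := mul_le_mul_of_nonneg_left hle hη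
        rw [abs_of_nonneg (by linarith)]
        linarith
    calc |P * u - Q * v| = |(P - Q) * u + Q * (u - v)| := by ring_nf
      _ ≤ |P - Q| * u + Q * |u - v| := by
          refine (abs_add_le _ _).trans ?_
          rw [abs_mul, abs_mul, abs_of_nonneg hu, abs_of_nonneg p2]
      _ ≤ η * P * (g 0 + g 1 + g 2) + Q * (η * (h 0 + h 1 + h 2)) := by gcongr
      _ = η * (P * (g 0 + g 1 + g 2)) + η * (Q * (h 0 + h 1 + h 2)) := by ring
      _ ≤ η * C + η * C := by gcongr
      _ = 2 * η * C := by ring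
  fin_cases i
  · exact key (g 0) (h 0) g0 (by linarith) c0
  · exact key (g 1) (h 1) g1 (by linarith) c1
  · exact key (g 2) (h 2) g2 (by linarith) c2
  · exact absurd rfl hi

/-- Along words ending in two distinct letters all pairs of curvatures are comparable. -/
theorem IsCurv.sum_le_pair {g : Fin 4 → ℝ} (hg : IsCurv g) {j k : Fin 3} (hjk : j ≠ k)
    {h : Fin 4 → ℝ} (hh : h = (g ᵥ* Mmat j) ᵥ* Mmat k) :
    h 0 + h 1 + h 2 ≤ 6 * (h 1 + h 2) ∧ h 0 + h 1 + h 2 ≤ 6 * (h 0 + h 2) ∧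
      h 0 + h 1 + h 2 ≤ 6 * (h 0 + h 1) := by
  obtain ⟨h0, h1, h2, h3, -⟩ := hg
  subst hh
  fin_cases j <;> fin_cases k <;> first
    | exact absurd rfl hjk
    | (simp only [Fin.reduceFinMk, Fin.zero_eta, Fin.mk_one, vecMul_Mmat_zero, vecMul_Mmat_one,
        vecMul_Mmat_two, inscr, Matrix.cons_val]
       refine ⟨?_, ?_, ?_⟩ <;> linarith)

theorem exists_normalized_bound : ∃ C : ℝ, 0 < C ∧ ∀ g : Fin 4 → ℝ, IsCurv g →
    ∀ j k : Fin 3, j ≠ k → ∀ h, h = (g ᵥ* Mmat j) ᵥ* Mmat k →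
      HGamma h ^ (1 / dAG) * (h 0 + h 1 + h 2) ≤ C := by
  have href : IsCurv ![1, 1, 0, 1] := by
    constructor <;> simp only [ell, Matrix.cons_val] <;> norm_num
  set R := HGamma ![1, 1, 0, 1] ^ (1 / dAG) with hR
  have hRnn : 0 ≤ R := Real.rpow_nonneg ENNReal.toReal_nonneg _
  refine ⟨24 * R + 1, by positivity, fun g hg j k hjk h hh => ?_⟩
  have hhc : IsCurv h := hh ▸ (hg.vecMul_Mmat j).vecMul_Mmat k
  obtain ⟨s0, s1, s2⟩ := hg.sum_le_pair hjk hh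
  have hS : 0 < h 0 + h 1 + h 2 := by
    have := hhc.pair_pos.1
    have := hhc.zero
    linarith
  set S := h 0 + h 1 + h 2 with hSdef
  have hle := HGamma_rpow_le href hhc (K := 24 / S) (by positivity) fun x hx => by
    have h1 := hx.le_ell hhc.three.le (c := S / 6) (by linarith) (by linarith) (by linarith)
    have h2 := (le_abs_self _).trans (hx.abs_ell_le (v := ![1, 1, 0, 1]) (m := 1) (n := 1)
      (by simp) (by simp) (by simp) (by simp))
    calc ell x ![1, 1, 0, 1] ≤ x 0 + x 1 + x 2 := by linarith
      _ = 24 / S * (S / 6 / 4 * (x 0 + x 1 + x 2)) := by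
        linear_combination -(x 0 + x 1 + x 2) * mul_inv_cancel₀ hS.ne'
      _ ≤ 24 / S * ell x h := by gcongr
  calc HGamma h ^ (1 / dAG) * S ≤ 24 / S * R * S := by gcongr
    _ = 24 * R := by field_simp
    _ ≤ 24 * R + 1 := by linarith

theorem half_sq_le_kappa_sq {g : Fin 4 → ℝ} {ε : ℝ} (hε : 0 < ε) (hg : g ∈ GammaEps ε) :
    g 3 ^ 2 = g 1 * g 2 + g 2 * g 0 + g 0 * g 1 ∧ ε / 2 ≤ g 3 := by
  obtain ⟨⟨h0, -⟩, ⟨h1, -⟩, ⟨h2, -⟩, h3, s12, s20, s01⟩ := hg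
  have hsq : g 3 ^ 2 = g 1 * g 2 + g 2 * g 0 + g 0 * g 1 := by
    rw [h3, kappa, Real.sq_sqrt (by positivity)]
  refine ⟨hsq, ?_⟩
  have h3n : 0 ≤ g 3 := by rw [h3]; exact Real.sqrt_nonneg _
  refine le_of_sq_le_sq ?_ h3n
  rw [hsq]
  have p12 := mul_nonneg h1 h2
  have p20 := mul_nonneg h2 h0
  rcases le_total (ε / 2) (g 0) with h | h
  · have := mul_le_mul h s12 hε.le h0
    nlinarith
  · have h' : ε / 2 ≤ g 1 := by linarith
    have := mul_le_mul h' s20 hε.le h1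
    nlinarith

theorem isCurv_of_mem_GammaEps {g : Fin 4 → ℝ} {ε : ℝ} (hε : 0 < ε) (hg : g ∈ GammaEps ε) :
    IsCurv g := by
  obtain ⟨hsq, h3⟩ := half_sq_le_kappa_sq hε hg
  obtain ⟨⟨h0, -⟩, ⟨h1, -⟩, ⟨h2, -⟩, -⟩ := hg
  refine ⟨h0, h1, h2, by linarith, ?_⟩
  simp only [ell]
  linarith

theorem abs_sub_le_rhoGamma (g h : Fin 4 → ℝ) : |g 0 - h 0| ≤ rhoGamma g h ∧
    |g 1 - h 1| ≤ rhoGamma g h ∧ |g 2 - h 2| ≤ rhoGamma g h := by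
  refine ⟨?_, ?_, ?_⟩ <;> rw [rhoGamma] <;> apply Real.abs_le_sqrt <;>
    nlinarith [sq_nonneg (g 0 - h 0), sq_nonneg (g 1 - h 1), sq_nonneg (g 2 - h 2)]

theorem abs_sub_three_le {g h : Fin 4 → ℝ} {ε : ℝ} (hε : 0 < ε) (hg : g ∈ GammaEps ε)
    (hh : h ∈ GammaEps ε) : |g 3 - h 3| ≤ 6 * (ε⁻¹ ^ 2 * rhoGamma g h) := by
  obtain ⟨gsq, g3⟩ := half_sq_le_kappa_sq hε hg
  obtain ⟨hsq, h3⟩ := half_sq_le_kappa_sq hε hh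
  obtain ⟨⟨a0, b0⟩, ⟨a1, b1⟩, ⟨a2, b2⟩, -⟩ := hg
  obtain ⟨⟨a0', b0'⟩, ⟨a1', b1'⟩, ⟨a2', b2'⟩, -⟩ := hh
  obtain ⟨d0, d1, d2⟩ := abs_sub_le_rhoGamma g h
  set ρ := rhoGamma g h
  have hprod : ∀ u v u' v' : ℝ, 0 ≤ u → u ≤ ε⁻¹ → 0 ≤ v' → v' ≤ ε⁻¹ → |u - u'| ≤ ρ →
      |v - v'| ≤ ρ → |u * v - u' * v'| ≤ 2 * (ε⁻¹ * ρ) := by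
    intro u v u' v' hu hu' hv hv' h1 h2
    calc |u * v - u' * v'| = |u * (v - v') + v' * (u - u')| := by ring_nf
      _ ≤ u * |v - v'| + v' * |u - u'| := by
          refine (abs_add_le _ _).trans ?_
          rw [abs_mul, abs_mul, abs_of_nonneg hu, abs_of_nonneg hv]
      _ ≤ ε⁻¹ * ρ + ε⁻¹ * ρ := by gcongr
      _ = 2 * (ε⁻¹ * ρ) := by ring
  have e1 := hprod (g 1) (g 2) (h 1) (h 2) a1 b1 a2' b2' d1 d2
  have e2 := hprod (g 2) (g 0) (h 2) (h 0) a2 b2 a0' b0' d2 d0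
  have e3 := hprod (g 0) (g 1) (h 0) (h 1) a0 b0 a1' b1' d0 d1
  have hfac : (g 3 - h 3) * (g 3 + h 3) = (g 1 * g 2 - h 1 * h 2) + (g 2 * g 0 - h 2 * h 0) +
      (g 0 * g 1 - h 0 * h 1) := by linear_combination gsq - hsq
  have habs : |g 3 - h 3| * (g 3 + h 3) ≤ 6 * (ε⁻¹ * ρ) := by
    rw [← abs_of_pos (show 0 < g 3 + h 3 by linarith), ← abs_mul, hfac]
    refine (abs_add_three _ _ _).trans ?_
    linarith
  have h6 : |g 3 - h 3| * ε ≤ 6 * (ε⁻¹ * ρ) :=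
    (mul_le_mul_of_nonneg_left (by linarith) (abs_nonneg _)).trans habs
  calc |g 3 - h 3| = |g 3 - h 3| * ε * ε⁻¹ := by field_simp
    _ ≤ 6 * (ε⁻¹ * ρ) * ε⁻¹ := by gcongr
    _ = 6 * (ε⁻¹ ^ 2 * ρ) := by ring

theorem relClose_of_mem_GammaEps {g h : Fin 4 → ℝ} {ε : ℝ} (hε : ε ∈ Set.Ioo (0 : ℝ) 1)
    (hg : g ∈ GammaEps ε) (hh : h ∈ GammaEps ε) :
    RelClose (16 * (ε⁻¹ ^ 3 * rhoGamma g h)) g h := by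
  obtain ⟨h0, h1⟩ := hε
  intro x hx
  have d3 := abs_sub_three_le h0 hg hh
  obtain ⟨d0, d1, d2⟩ := abs_sub_le_rhoGamma g h
  have hinv : 1 ≤ ε⁻¹ := (one_le_inv₀ h0).2 h1.le
  have hρ : 0 ≤ rhoGamma g h := Real.sqrt_nonneg _
  have hs : 0 ≤ x 0 + x 1 + x 2 := by
    have := hx.zero
    have := hx.one
    have := hx.two
    positivity
  set ρ := rhoGamma g h
  have hρ2 : ρ ≤ ε⁻¹ ^ 2 * ρ := le_mul_of_one_le_left hρ (one_le_pow₀ hinv)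
  have hsub : ell x g - ell x h = ell x (g - h) := by
    simp only [ell, Pi.sub_apply]; ring
  have hup : |ell x g - ell x h| ≤ 4 * (ε⁻¹ ^ 2 * ρ) * (x 0 + x 1 + x 2) := by
    rw [hsub]
    refine (hx.abs_ell_le (v := g - h) d0 d1 d2 d3).trans ?_
    gcongr
    linarith
  have hlow : ∀ g ∈ GammaEps ε,
      4 * (ε⁻¹ ^ 2 * ρ) * (x 0 + x 1 + x 2) ≤ 16 * (ε⁻¹ ^ 3 * ρ) * ell x g := by
    intro g hg
    have hc := (isCurv_of_mem_GammaEps h0 hg).three.le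
    obtain ⟨-, -, -, -, s12, s20, s01⟩ := hg
    have := hx.le_ell (c := ε) hc s12 (by linarith) s01
    calc 4 * (ε⁻¹ ^ 2 * ρ) * (x 0 + x 1 + x 2)
        = 16 * (ε⁻¹ ^ 3 * ρ) * (ε / 4 * (x 0 + x 1 + x 2)) := by
          linear_combination -4 * ε⁻¹ ^ 2 * ρ * (x 0 + x 1 + x 2) * inv_mul_cancel₀ h0.ne'
      _ ≤ 16 * (ε⁻¹ ^ 3 * ρ) * ell x g := by gcongr
  exact ⟨hup.trans (hlow g hg), hup.trans (hlow h hh)⟩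

theorem rhoGamma_le_of_abs_sub_le {g h : Fin 4 → ℝ} {r : ℝ} (h0 : |g 0 - h 0| ≤ r)
    (h1 : |g 1 - h 1| ≤ r) (h2 : |g 2 - h 2| ≤ r) : rhoGamma g h ≤ 2 * r := by
  have hr : 0 ≤ r := (abs_nonneg _).trans h0
  refine Real.sqrt_le_iff.2 ⟨by positivity, ?_⟩
  have := sq_le_sq' (abs_le.1 h0).1 (abs_le.1 h0).2
  have := sq_le_sq' (abs_le.1 h1).1 (abs_le.1 h1).2
  have := sq_le_sq' (abs_le.1 h2).1 (abs_le.1 h2).2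
  nlinarith [sq_nonneg r]

/-- Every word of the form `w ++ τ` with `τ ∈ I` ends in two distinct letters. -/
theorem exists_append_eq {τ : Word} (hτ : τ ∈ IdxI) (w : Word) :
    ∃ (v : Word) (j k : Fin 3), j ≠ k ∧ w ++ τ = v ++ [j, k] := by
  obtain ⟨j, k, hjk, n, hn, rfl⟩ := hτ
  obtain ⟨m, rfl⟩ := Nat.exists_eq_succ_of_ne_zero hn.ne'
  refine ⟨w ++ List.replicate m j, j, k, hjk, ?_⟩
  rw [List.replicate_succ']
  simp

end Apollonian

/-- uniform Lipschitz estimate for the normalized map along words `wτ`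
with `τ ∈ I`. -/
theorem normalized_Mword_IdxI_lipschitz :
    ∃ c₇ : ℝ, 0 < c₇ ∧ ∀ ε : ℝ, ε ∈ Set.Ioo (0:ℝ) 1 →
      ∀ g₁ ∈ GammaEps ε, ∀ g₂ ∈ GammaEps ε, ∀ w : Word, ∀ τ ∈ IdxI,
        rhoGamma
          ((HGamma (Matrix.vecMul g₁ (Mword (w ++ τ))) ^ (1 / dAG)) •
            Matrix.vecMul g₁ (Mword (w ++ τ)))
          ((HGamma (Matrix.vecMul g₂ (Mword (w ++ τ))) ^ (1 / dAG)) •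
            Matrix.vecMul g₂ (Mword (w ++ τ))) ≤
        c₇ * ε ^ (-(45 * dAG)) * rhoGamma g₁ g₂ := by
  obtain ⟨C, hC, hbound⟩ := Apollonian.exists_normalized_bound
  refine ⟨64 * C, by positivity, fun ε hε g₁ hg₁ g₂ hg₂ w τ hτ => ?_⟩
  obtain ⟨v, j, k, hjk, hv⟩ := Apollonian.exists_append_eq hτ w
  have hρ : 0 ≤ rhoGamma g₁ g₂ := Real.sqrt_nonneg _
  have hη : 0 ≤ 16 * (ε⁻¹ ^ 3 * rhoGamma g₁ g₂) := by
    have := hε.1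
    positivity
  have c₁ := Apollonian.isCurv_of_mem_GammaEps hε.1 hg₁
  have c₂ := Apollonian.isCurv_of_mem_GammaEps hε.1 hg₂
  have hlast : ∀ g : Fin 4 → ℝ, g ᵥ* Mword (w ++ τ) = ((g ᵥ* Mword v) ᵥ* Mmat j) ᵥ* Mmat k := by
    intro g
    rw [hv, Apollonian.vecMul_Mword_append, Apollonian.vecMul_Mword_cons, Apollonian.vecMul_Mword_cons, Apollonian.vecMul_Mword_nil]
  have key := fun i hi => ((Apollonian.relClose_of_mem_GammaEps hε hg₁ hg₂).vecMul_Mword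
    (w ++ τ)).abs_normalized_sub_le hη (c₁.vecMul_Mword _) (c₂.vecMul_Mword _)
    (hbound _ (c₁.vecMul_Mword v) j k hjk _ (hlast g₁))
    (hbound _ (c₂.vecMul_Mword v) j k hjk _ (hlast g₂)) (i := i) hi
  refine (Apollonian.rhoGamma_le_of_abs_sub_le (key 0 (by decide)) (key 1 (by decide))
    (key 2 (by decide))).trans ?_
  have hpow : ε⁻¹ ^ 3 ≤ ε ^ (-(45 * dAG)) := by
    have hd := Apollonian.one_le_dAG
    have : ε⁻¹ ^ 3 = ε ^ (-3 : ℝ) := by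
      rw [inv_pow, Real.rpow_neg hε.1.le]
      norm_cast
    rw [this]
    exact Real.rpow_le_rpow_of_exponent_ge hε.1 hε.2.le (by linarith)
  calc 2 * (2 * (16 * (ε⁻¹ ^ 3 * rhoGamma g₁ g₂)) * C)
      = 64 * C * ε⁻¹ ^ 3 * rhoGamma g₁ g₂ := by ring
    _ ≤ 64 * C * ε ^ (-(45 * dAG)) * rhoGamma g₁ g₂ := by gcongr
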